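/- arXiv:math/0606716 — 5 statements merged into one kernel-verified Lean document; each statement's English description precedes it below -/
import Mathlib

section
/- Let m be a positive integer and let D ⊂ ℕ² be a diagram with #D = binom(m+1,2). Then the system L_D(m) is non-special if and only if there is no nonzero polynomial f ∈ K[X,Y] of total degree at most m−1 vanishing at every point of D, where a point (i,j) ∈ D ⊂ ℕ² is regarded as the point of K² obtained via the natural map ℕ → K. -/
open MvPolynomial

/-- The differential operator `∂^{β₁}_X ∂^{β₂}_Y` on `K[X,Y]` (with `X` the variable `0`
and `Y` the variable `1`). -/
noncomputable def derivOp (K : Type*) [CommRing K] (β : ℕ × ℕ) :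
    Module.End K (MvPolynomial (Fin 2) K) :=
  ((pderiv (0 : Fin 2)).toLinearMap ^ β.1) * ((pderiv (1 : Fin 2)).toLinearMap ^ β.2)

/-- Evaluation of a polynomial in `K[X,Y]` at a point of `K²`, as a linear map. -/
noncomputable def evalPt (K : Type*) [CommRing K] (p : K × K) :
    MvPolynomial (Fin 2) K →ₗ[K] K :=
  (MvPolynomial.aeval (fun i : Fin 2 => if i = 0 then p.1 else p.2)).toLinearMap

/-- The space of polynomials whose monomial support is contained in the diagram `D`. -/
noncomputable def monoSpan (K : Type*) [Field K] (D : Finset (ℕ × ℕ)) :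
    Submodule K (MvPolynomial (Fin 2) K) :=
  Submodule.span K ((fun d : ℕ × ℕ =>
    (monomial (Finsupp.single (0 : Fin 2) d.1 + Finsupp.single 1 d.2) (1 : K))) '' D)

/-- `L_D(m₁p₁, …, m_rp_r)`: the space of polynomials supported on `D` whose partial
derivatives of total order `< m j` all vanish at the point `p j`, for `j = 1, …, r`. -/
noncomputable def linSysPts (K : Type*) [Field K] (D : Finset (ℕ × ℕ)) {r : ℕ}
    (m : Fin r → ℕ) (p : Fin r → K × K) : Submodule K (MvPolynomial (Fin 2) K) :=
  monoSpan K D ⊓ ⨅ j : Fin r, ⨅ β : ℕ × ℕ, ⨅ _ : β.1 + β.2 < m j,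
    LinearMap.ker (evalPt K (p j) ∘ₗ derivOp K β)

/-- `dim L_D(m₁,…,m_r)`: the minimum over all tuples of points of `dim_K L − 1`. -/
noncomputable def dimSys (K : Type*) [Field K] (D : Finset (ℕ × ℕ)) {r : ℕ}
    (m : Fin r → ℕ) : ℤ :=
  sInf (Set.range fun p : Fin r → K × K =>
    (Module.finrank K ↥(linSysPts K D m p) : ℤ) - 1)

/-- The virtual dimension `vdim = #D − 1 − Σ_j C(m_j + 1, 2)`. -/
def vdimSys (D : Finset (ℕ × ℕ)) {r : ℕ} (m : Fin r → ℕ) : ℤ :=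
  (D.card : ℤ) - 1 - ∑ j : Fin r, (((m j + 1).choose 2 : ℕ) : ℤ)

/-- A system is non-special if its dimension equals the expected dimension
`edim = max (vdim, −1)`. -/
def nonSpecial (K : Type*) [Field K] (D : Finset (ℕ × ℕ)) {r : ℕ}
    (m : Fin r → ℕ) : Prop :=
  dimSys K D m = max (vdimSys D m) (-1)

noncomputable def sx (d : ℕ × ℕ) : Fin 2 →₀ ℕ := Finsupp.single 0 d.1 + Finsupp.single 1 d.2

lemma sx_inj : Function.Injective sx := by
  rintro ⟨a, b⟩ ⟨c, d⟩ h
  have h0 := DFunLike.congr_fun h 0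
  have h1 := DFunLike.congr_fun h 1
  simp [sx] at h0 h1
  simp [h0, h1]

lemma sx_surj (n : Fin 2 →₀ ℕ) : sx (n 0, n 1) = n := by
  ext i
  fin_cases i <;> simp [sx]

def TT (m : ℕ) : Finset (ℕ × ℕ) := (Finset.range m).biUnion (fun k => Finset.HasAntidiagonal.antidiagonal k)

lemma mem_TT (m : ℕ) (β : ℕ × ℕ) : β ∈ TT m ↔ β.1 + β.2 < m := by
  simp [TT]

lemma card_TT (m : ℕ) : (TT m).card = (m + 1).choose 2 := by
  unfold TT
  rw [Finset.card_biUnion]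
  · induction m with
    | zero => rfl
    | succ k ih =>
      rw [Finset.sum_range_succ, ih, Finset.Nat.card_antidiagonal, Nat.choose_succ_succ' (k+1) 1]
      simp [add_comm]
  · intro a _ b _ hab
    rw [Function.onFun, Finset.disjoint_left]
    intro x hx hy
    rw [Finset.HasAntidiagonal.mem_antidiagonal] at hx hy
    omega

lemma iter0 (K : Type*) [Field K] (k a b : ℕ) (c : K) :
    (((pderiv (0 : Fin 2)).toLinearMap ^ k : Module.End K (MvPolynomial (Fin 2) K)))
      (monomial (sx (a, b)) c) = monomial (sx (a - k, b)) (c * (a.descFactorial k : K)) := by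
  induction k with
  | zero => simp
  | succ k ih =>
    rw [pow_succ', Module.End.mul_apply, ih]
    simp only [Derivation.coeFn_coe, pderiv_monomial]
    have h1 : sx (a - k, b) - Finsupp.single 0 1 = sx (a - (k+1), b) := by
      ext i; fin_cases i <;> simp [sx]; omega
    rw [h1]
    congr 1
    rw [Nat.descFactorial_succ]
    simp [sx]; ring

lemma iter1 (K : Type*) [Field K] (k a b : ℕ) (c : K) :
    (((pderiv (1 : Fin 2)).toLinearMap ^ k : Module.End K (MvPolynomial (Fin 2) K)))
      (monomial (sx (a, b)) c) = monomial (sx (a, b - k)) (c * (b.descFactorial k : K)) := by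
  induction k with
  | zero => simp
  | succ k ih =>
    rw [pow_succ', Module.End.mul_apply, ih]
    simp only [Derivation.coeFn_coe, pderiv_monomial]
    have h1 : sx (a, b - k) - Finsupp.single 1 1 = sx (a, b - (k+1)) := by
      ext i; fin_cases i <;> simp [sx]; omega
    rw [h1]
    congr 1
    rw [Nat.descFactorial_succ]
    simp [sx]; ring

lemma eval_sx (K : Type*) [Field K] (u v : K) (d : ℕ × ℕ) (c : K) :
    eval (fun i : Fin 2 => if i = 0 then u else v) (monomial (sx d) c)
      = c * (u ^ d.1 * v ^ d.2) := by
  rw [eval_monomial, Finsupp.prod_fintype _ _ (by simp)]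
  simp [sx]

lemma entry (K : Type*) [Field K] (p : K × K) (β d : ℕ × ℕ) :
    evalPt K p (derivOp K β (monomial (sx d) 1)) =
      (d.1.descFactorial β.1 : K) * (d.2.descFactorial β.2 : K) *
        (p.1 ^ (d.1 - β.1) * p.2 ^ (d.2 - β.2)) := by
  obtain ⟨a, b⟩ := d
  rw [derivOp, Module.End.mul_apply, iter1, iter0]
  have := eval_sx K p.1 p.2 (a - β.1, b - β.2)
    (1 * (b.descFactorial β.2 : K) * (a.descFactorial β.1 : K))
  simp only [evalPt, AlgHom.toLinearMap_apply, coe_aeval_eq_eval]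
  refine this.trans ?_
  ring

section mats
variable (K : Type*) [Field K] {m : ℕ} (d : TT m → ℕ × ℕ)

def MA : Matrix (TT m) (TT m) K := fun β i =>
  ((d i).1.descFactorial β.1.1 : K) * ((d i).2.descFactorial β.1.2 : K)

def MM (p : K × K) : Matrix (TT m) (TT m) K := fun β i =>
  MA K d β i * (p.1 ^ ((d i).1 - β.1.1) * p.2 ^ ((d i).2 - β.1.2))

def MV : Matrix (TT m) (TT m) K := fun i α =>
  ((d i).1 : K) ^ α.1.1 * ((d i).2 : K) ^ α.1.2

noncomputable def MB (m : ℕ) : Matrix (TT m) (TT m) K := fun α β =>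
  (descPochhammer K β.1.1).coeff α.1.1 * (descPochhammer K β.1.2).coeff α.1.2

lemma MB_det : (MB K m).det ≠ 0 := by
  classical
  intro h
  obtain ⟨c, hc, h0⟩ := Matrix.exists_mulVec_eq_zero_iff.mpr h
  obtain ⟨β₀, hβ₀⟩ := Function.ne_iff.mp hc
  obtain ⟨β, hβ, hmax⟩ := Finset.exists_max_image
    (Finset.univ.filter fun β : TT m => c β ≠ 0) (fun β => β.1.1 + β.1.2)
    ⟨β₀, by simpa using hβ₀⟩
  simp only [Finset.mem_filter, Finset.mem_univ, true_and] at hβ hmax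
  have h1 := congrFun h0 β
  rw [Matrix.mulVec, dotProduct, Finset.sum_eq_single β] at h1
  · have e (n : ℕ) : (descPochhammer K n).coeff n = 1 := by
      have := (monic_descPochhammer K n).coeff_natDegree
      rwa [descPochhammer_natDegree] at this
    simp [MB, e] at h1
    exact hβ h1
  · intro γ _ hγ
    by_cases hc : c γ = 0
    · simp [hc]
    have hm := hmax γ hc
    have : γ.1.1 < β.1.1 ∨ γ.1.2 < β.1.2 := by
      by_contra hh
      push Not at hh
      apply hγ
      ext <;> omega
    unfold MB
    rcases this with h | h
    · rw [Polynomial.coeff_eq_zero_of_natDegree_lt (n := β.1.1)]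
      · simp
      · rwa [descPochhammer_natDegree]
    · rw [Polynomial.coeff_eq_zero_of_natDegree_lt (n := β.1.2)]
      · simp
      · rwa [descPochhammer_natDegree]
  · simp

lemma descF (n k N : ℕ) (h : k < N) : (n.descFactorial k : K) =
    ∑ a ∈ Finset.range N, (n : K) ^ a * (descPochhammer K k).coeff a := by
  rw [← descPochhammer_eval_eq_descFactorial, Polynomial.eval_eq_sum_range' (n := N)]
  · simp [mul_comm]
  · rwa [descPochhammer_natDegree]

lemma MA_eq : (MA K d).transpose = MV K d * MB K m := by
  ext i β
  have hβ := (mem_TT m β.1).mp β.2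
  rw [Matrix.mul_apply, Matrix.transpose_apply, MA, descF K _ _ (β.1.1+1) (by omega),
    descF K _ _ (β.1.2+1) (by omega), Finset.sum_mul_sum, ← Finset.sum_product']
  simp only [MV, MB]
  rw [Finset.sum_coe_sort (TT m) (fun α => ((d i).1 : K) ^ α.1 * ((d i).2 : K) ^ α.2 *
    ((descPochhammer K β.1.1).coeff α.1 * (descPochhammer K β.1.2).coeff α.2))]
  have : Finset.range (β.1.1+1) ×ˢ Finset.range (β.1.2+1) ⊆ TT m := by
    intro x hx
    rw [Finset.mem_product, Finset.mem_range, Finset.mem_range] at hx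
    rw [mem_TT]; omega
  rw [← Finset.sum_subset this]
  · apply Finset.sum_congr rfl
    intros; ring
  · intro x _ hx
    have : β.1.1 < x.1 ∨ β.1.2 < x.2 := by
      by_contra hh
      apply hx
      rw [Finset.mem_product, Finset.mem_range, Finset.mem_range]
      omega
    rcases this with h | h
    · rw [Polynomial.coeff_eq_zero_of_natDegree_lt (n := x.1)]
      · simp
      · rwa [descPochhammer_natDegree]
    · rw [Polynomial.coeff_eq_zero_of_natDegree_lt (n := x.2)]
      · simp
      · rwa [descPochhammer_natDegree]

lemma det_A_V : (MA K d).det = 0 ↔ (MV K d).det = 0 := by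
  rw [← Matrix.det_transpose, MA_eq, Matrix.det_mul]
  simp [MB_det]

noncomputable def PP : Matrix (TT m) (TT m) (MvPolynomial (Fin 2) K) := fun β i =>
  C (MA K d β i) * (X 0 ^ ((d i).1 - β.1.1) * X 1 ^ ((d i).2 - β.1.2))

lemma det_PP (h : (MA K d).det = 0) : (PP K d).det = 0 := by
  have e : Matrix.diagonal (fun β : TT m => (X 0 ^ β.1.1 * X 1 ^ β.1.2 : MvPolynomial (Fin 2) K))
      * PP K d = (MA K d).map C * Matrix.diagonal (fun i => X 0 ^ (d i).1 * X 1 ^ (d i).2) := by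
    ext1 β i
    rw [Matrix.diagonal_mul, Matrix.mul_diagonal, Matrix.map_apply, PP]
    by_cases hh : β.1.1 ≤ (d i).1 ∧ β.1.2 ≤ (d i).2
    · obtain ⟨a, ha⟩ := Nat.exists_eq_add_of_le hh.1
      obtain ⟨b, hb⟩ := Nat.exists_eq_add_of_le hh.2
      rw [ha, hb]
      simp only [Nat.add_sub_cancel_left, pow_add]
      ring
    · have : MA K d β i = 0 := by
        unfold MA
        by_cases h1 : β.1.1 ≤ (d i).1
        · rw [Nat.descFactorial_of_lt (n := (d i).2) (by omega)]; simp
        · rw [Nat.descFactorial_of_lt (n := (d i).1) (by omega)]; simp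
      simp [this]
  have h2 := congrArg Matrix.det e
  rw [Matrix.det_mul, Matrix.det_mul, Matrix.det_diagonal] at h2
  have h3 : ((MA K d).map (C : K →+* MvPolynomial (Fin 2) K)).det = 0 := by
    have := RingHom.map_det (C : K →+* MvPolynomial (Fin 2) K) (MA K d)
    rw [h, map_zero] at this
    exact this.symm
  rw [h3, zero_mul] at h2
  refine (mul_eq_zero.mp h2).resolve_left ?_
  rw [← ne_eq, Finset.prod_ne_zero_iff]
  intro β _
  exact mul_ne_zero (pow_ne_zero _ (X_ne_zero _)) (pow_ne_zero _ (X_ne_zero _))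

lemma det_MM (h : (MA K d).det = 0) (p : K × K) : (MM K d p).det = 0 := by
  have := RingHom.map_det (eval (fun i : Fin 2 => if i = 0 then p.1 else p.2)) (PP K d)
  rw [det_PP K d h, map_zero] at this
  rw [this]
  congr 1
  ext β i
  simp [MM, PP]

lemma sum_mono_eq_zero (hd : Function.Injective d) (c : TT m → K)
    (h : ∑ i, c i • (monomial (sx (d i)) (1 : K)) = 0) : c = 0 := by
  have hl : LinearIndependent K (fun i => (monomial (sx (d i)) (1 : K))) := by
    have := (basisMonomials (Fin 2) K).linearIndependent.comp (fun i => sx (d i))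
      (sx_inj.comp hd)
    simpa [Function.comp_def] using this
  funext i
  exact Fintype.linearIndependent_iff.mp hl c h i

lemma linSys_bot_iff (D : Finset (ℕ × ℕ)) (e : TT m ≃ D) (p : Fin 1 → K × K) :
    linSysPts K D (fun _ : Fin 1 => m) p = ⊥ ↔ (MM K (fun i => (e i).1) (p 0)).det ≠ 0 := by
  have hinj : Function.Injective (fun i => (e i).1) := Subtype.val_injective.comp e.injective
  have key (c : TT m → K) (β : TT m) : evalPt K (p 0) (derivOp K β.1
      (∑ i, c i • (monomial (sx (e i).1) (1 : K)))) =
      (MM K (fun i => (e i).1) (p 0)).mulVec c β := by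
    simp only [map_sum, map_smul, entry, Matrix.mulVec, dotProduct, MM, MA, smul_eq_mul]
    apply Finset.sum_congr rfl
    intros; ring
  rw [← not_iff_not, not_not, ← Matrix.exists_mulVec_eq_zero_iff, ← ne_eq, Submodule.ne_bot_iff]
  constructor
  · rintro ⟨g, hg, hg0⟩
    rw [linSysPts, Submodule.mem_inf] at hg
    obtain ⟨h1, h2⟩ := hg
    obtain ⟨c, rfl⟩ : ∃ c : TT m → K, ∑ i, c i • (monomial (sx (e i).1) (1 : K)) = g := by
      have : monoSpan K D = Submodule.span K (Set.range fun i => monomial (sx (e i).1) (1 : K)) := by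
        unfold monoSpan
        congr 1
        ext x
        constructor
        · rintro ⟨y, hy, rfl⟩
          exact ⟨e.symm ⟨y, hy⟩, by simp [sx]⟩
        · rintro ⟨i, rfl⟩
          exact ⟨(e i).1, (e i).2, rfl⟩
      rw [this] at h1
      exact (Submodule.mem_span_range_iff_exists_fun K).mp h1
    refine ⟨c, ?_, ?_⟩
    · rintro rfl
      simp at hg0
    · funext β
      rw [← key]
      simp only [Submodule.mem_iInf] at h2
      exact h2 0 β.1 ((mem_TT _ _).mp β.2)
  · rintro ⟨c, hc, h0⟩
    refine ⟨∑ i, c i • (monomial (sx (e i).1) (1 : K)), ?_, ?_⟩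
    · rw [linSysPts, Submodule.mem_inf]
      constructor
      · apply Submodule.sum_mem
        intro i _
        apply Submodule.smul_mem
        exact Submodule.subset_span ⟨(e i).1, (e i).2, rfl⟩
      · simp only [Submodule.mem_iInf]
        intro j β hβ
        obtain rfl : j = 0 := Subsingleton.elim _ _
        have := key c ⟨β, (mem_TT _ _).mpr hβ⟩
        rw [h0] at this
        exact this
    · intro h
      exact hc (sum_mono_eq_zero K (fun i => (e i).1) hinj c h)

lemma poly_iff (hm : 0 < m) (D : Finset (ℕ × ℕ)) (e : TT m ≃ D) :
    (∃ f : MvPolynomial (Fin 2) K, f ≠ 0 ∧ f.totalDegree ≤ m - 1 ∧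
        ∀ d ∈ D, eval (fun i : Fin 2 => if i = 0 then (d.1 : K) else (d.2 : K)) f = 0)
      ↔ (MV K (fun i => (e i).1)).det = 0 := by
  have key (c : TT m → K) (i : TT m) :
      eval (fun j : Fin 2 => if j = 0 then ((e i).1.1 : K) else ((e i).1.2 : K))
      (∑ α, c α • (monomial (sx α.1) (1 : K))) = (MV K (fun i => (e i).1)).mulVec c i := by
    simp only [map_sum, smul_eval, eval_sx, Matrix.mulVec, dotProduct, MV]
    apply Finset.sum_congr rfl
    intros; ring
  rw [← Matrix.exists_mulVec_eq_zero_iff]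
  constructor
  · rintro ⟨f, hf, hdeg, hv⟩
    have hfe : ∑ α : TT m, coeff (sx α.1) f • (monomial (sx α.1) (1 : K)) = f := by
      ext n
      rw [coeff_sum]
      simp only [coeff_smul, coeff_monomial, smul_eq_mul]
      by_cases hn : (n 0, n 1) ∈ TT m
      · rw [Finset.sum_eq_single ⟨_, hn⟩]
        · simp [sx_surj]
        · intro b _ hb
          rw [if_neg, mul_zero]
          intro h
          apply hb
          rw [← sx_surj n] at h
          exact Subtype.ext (sx_inj h)
        · simp
      · rw [Finset.sum_eq_zero]
        · symm
          by_contra hc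
          apply hn
          have := (le_totalDegree (mem_support_iff.mpr hc)).trans hdeg
          rw [Finsupp.sum_fintype _ _ (by simp)] at this
          simp at this
          rw [mem_TT]
          simp only
          omega
        · intro b _
          rw [if_neg, mul_zero]
          intro h
          apply hn
          rw [← sx_surj n] at h
          rw [← sx_inj h]
          exact b.2
    refine ⟨fun α => coeff (sx α.1) f, ?_, ?_⟩
    · intro h
      apply hf
      rw [← hfe]
      apply Finset.sum_eq_zero
      intro α _
      rw [show coeff (sx α.1) f = 0 from congrFun h α, zero_smul]
    · funext i
      rw [← key, hfe]
      exact hv _ (e i).2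
  · rintro ⟨c, hc, h0⟩
    refine ⟨∑ α, c α • (monomial (sx α.1) (1 : K)), ?_, ?_, ?_⟩
    · intro h
      exact hc (sum_mono_eq_zero K (fun i => i.1) Subtype.val_injective c h)
    · apply totalDegree_finsetSum_le
      intro α _
      refine (totalDegree_smul_le _ _).trans ?_
      rw [totalDegree_monomial _ one_ne_zero, Finsupp.sum_fintype _ _ (by simp)]
      have := (mem_TT _ _).mp α.2
      simp [sx]
      omega
    · intro d hd
      have := key c (e.symm ⟨d, hd⟩)
      rw [h0] at this
      simpa using this

end mats

lemma nonSpecial_iff (K : Type*) [Field K] (m : ℕ) (D : Finset (ℕ × ℕ))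
    (hD : D.card = (m + 1).choose 2) :
    nonSpecial K D (fun _ : Fin 1 => m) ↔
      ∃ p, linSysPts K D (fun _ : Fin 1 => m) p = ⊥ := by
  have hfin (p) : Module.Finite K (linSysPts K D (fun _ : Fin 1 => m) p) := by
    have : Module.Finite K (monoSpan K D) := by
      unfold monoSpan
      exact Module.Finite.span_of_finite K (D.finite_toSet.image _)
    exact Submodule.finiteDimensional_of_le (inf_le_left : _ ≤ monoSpan K D)
  have hv : max (vdimSys D (fun _ : Fin 1 => m)) (-1) = -1 := by
    simp [vdimSys, hD]
  rw [nonSpecial, hv, dimSys]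
  set S := Set.range fun p : Fin 1 → K × K =>
    (Module.finrank K ↥(linSysPts K D (fun _ : Fin 1 => m) p) : ℤ) - 1 with hS
  have hne : S.Nonempty := Set.range_nonempty _
  have hlb : ∀ x ∈ S, -1 ≤ x := by
    rintro _ ⟨p, rfl⟩
    simp only
    omega
  constructor
  · intro h
    have hmem : sInf S ∈ S := Int.csInf_mem hne ⟨-1, hlb⟩
    rw [h] at hmem
    obtain ⟨p, hp⟩ := hmem
    refine ⟨p, ?_⟩
    have := hfin p
    rw [← Submodule.finrank_eq_zero (R := K)]
    simp only at hp
    omega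
  · rintro ⟨p, hp⟩
    apply le_antisymm
    · apply csInf_le ⟨-1, hlb⟩
      refine ⟨p, ?_⟩
      simp only
      rw [hp]
      simp
    · exact le_csInf hne hlb

/-- Let `m ≥ 1` and let `D` be a diagram with `#D = C(m+1, 2)`.  Then the
system `L_D(m)` is non-special if and only if there is no nonzero polynomial
`f ∈ K[X,Y]` of total degree at most `m − 1` vanishing at every point of `D` (points of
`D ⊂ ℕ²` being regarded as points of `K²` via the natural map `ℕ → K`). -/
theorem statement3 {K : Type*} [Field K] [CharZero K]
    (m : ℕ) (hm : 0 < m) (D : Finset (ℕ × ℕ)) (hD : D.card = (m + 1).choose 2) :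
    nonSpecial K D (fun _ : Fin 1 => m) ↔
      ¬ ∃ f : MvPolynomial (Fin 2) K, f ≠ 0 ∧ f.totalDegree ≤ m - 1 ∧
        ∀ d ∈ D,
          MvPolynomial.eval (fun i : Fin 2 => if i = 0 then (d.1 : K) else (d.2 : K)) f
            = 0 := by
  have hc : Fintype.card (TT m) = Fintype.card D := by
    rw [Fintype.card_coe, Fintype.card_coe, card_TT, hD]
  let e : TT m ≃ D := Fintype.equivOfCardEq hc
  rw [nonSpecial_iff K m D hD, poly_iff K hm D e, ← det_A_V]
  constructor
  · rintro ⟨p, hp⟩ h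
    rw [linSys_bot_iff K D e] at hp
    exact hp (det_MM K _ h _)
  · intro h
    refine ⟨fun _ => (1, 1), ?_⟩
    rw [linSys_bot_iff K D e]
    convert h using 3
    ext β i
    simp [MM]
end

section
/- (Diagram cutting.) Let m_1,…,m_r,m_{r+1},…,m_p be positive integers, let D ⊂ ℕ² be a diagram, and let F(α_1,α_2) = r_1α_1 + r_2α_2 + r_0 be an affine function with r_0,r_1,r_2 ∈ ℝ such that F(α) ≠ 0 for every α ∈ D. Set D_1 := {α ∈ D : F(α) < 0} and D_2 := {α ∈ D : F(α) > 0}. If the system L_2 := L_{D_2}(m_{r+1},…,m_p) is non-special and vdim L_2 = −1, then dim L_D(m_1,…,m_p) ≤ dim L_{D_1}(m_1,…,m_r). -/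
open MvPolynomial

theorem perturb_aux (A B : Finset (ℕ × ℕ)) (x y : ℝ)
    (h : ∀ α ∈ A, ∀ β ∈ B, x * β.1 + y * β.2 < x * α.1 + y * α.2) :
    ∃ a b : ℤ, ∀ α ∈ A, ∀ β ∈ B, a * (β.1 : ℤ) + b * β.2 < a * α.1 + b * α.2 := by
  let U : Set (ℝ × ℝ) := ⋂ α ∈ A, ⋂ β ∈ B,
    {z | z.1 * (β.1 : ℝ) + z.2 * β.2 < z.1 * α.1 + z.2 * α.2}
  have hU : IsOpen U := by
    refine isOpen_biInter_finset fun α _ => isOpen_biInter_finset fun β _ => ?_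
    exact isOpen_lt (by fun_prop) (by fun_prop)
  have hne : U.Nonempty := ⟨(x, y), by simpa [U] using fun a b hab c d hcd => h (a, b) hab (c, d) hcd⟩
  have hd : DenseRange (Prod.map ((↑) : ℚ → ℝ) ((↑) : ℚ → ℝ)) :=
    Rat.denseRange_cast.prodMap Rat.denseRange_cast
  obtain ⟨⟨u, v⟩, huv⟩ := hd.exists_mem_open hU hne
  refine ⟨u.num * v.den, v.num * u.den, fun α hα β hβ => ?_⟩
  simp only [U, Set.mem_iInter] at huv
  have h1 := huv α hα β hβ
  simp only [Prod.map, Set.mem_ofPred_eq] at h1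
  have h2 : u * β.1 + v * β.2 < u * α.1 + v * α.2 := by exact_mod_cast h1
  have hu : (0 : ℚ) < u.den := by exact_mod_cast u.den_pos
  have hv : (0 : ℚ) < v.den := by exact_mod_cast v.den_pos
  have e1 : (u.num : ℚ) = u * u.den := (Rat.mul_den_eq_num u).symm
  have e2 : (v.num : ℚ) = v * v.den := (Rat.mul_den_eq_num v).symm
  have h3 := mul_lt_mul_of_pos_right h2 (mul_pos hu hv)
  have : ((u.num * v.den : ℤ) : ℚ) * β.1 + ((v.num * u.den : ℤ) : ℚ) * β.2
      < ((u.num * v.den : ℤ) : ℚ) * α.1 + ((v.num * u.den : ℤ) : ℚ) * α.2 := by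
    push_cast
    rw [e1, e2]
    linarith
  exact_mod_cast this

theorem semicont_aux {K V W : Type*} [Field K] [Infinite K] [AddCommGroup V] [Module K V]
    [FiniteDimensional K V] [AddCommGroup W] [Module K W] (T : K → V →ₗ[K] W)
    (hT : ∀ (φ : W →ₗ[K] K) (v : V), ∃ p : Polynomial K, ∀ s, φ (T s v) = p.eval s) :
    ∃ s, s ≠ 0 ∧ Module.finrank K (LinearMap.ker (T s)) ≤
      Module.finrank K (LinearMap.ker (T 0)) := by
  obtain ⟨C, hC⟩ := (LinearMap.ker (T 0)).exists_isCompl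
  let b := Module.finBasis K C
  have hinj : Function.Injective ((T 0).domRestrict C) := by
    rw [← LinearMap.ker_eq_bot, LinearMap.ker_eq_bot']
    intro m hm
    have : (m : V) ∈ LinearMap.ker (T 0) ⊓ C := ⟨hm, m.2⟩
    rw [hC.inf_eq_bot] at this
    simpa using this
  obtain ⟨N, hN⟩ := ((T 0).domRestrict C).exists_leftInverse_of_injective
    (LinearMap.ker_eq_bot.mpr hinj)
  choose p hp using fun i j => hT (b.coord i ∘ₗ N) (b j)
  let M : Matrix _ _ (Polynomial K) := Matrix.of p
  have hM : ∀ s, M.det.eval s = (LinearMap.toMatrix b b (N ∘ₗ (T s).domRestrict C)).det := by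
    intro s
    rw [← Polynomial.coe_evalRingHom, RingHom.map_det]
    congr 1
    ext i j
    simp [M, ← hp, LinearMap.toMatrix_apply]
  have hM0 : M.det ≠ 0 := by
    intro h
    have := hM 0
    rw [hN, h] at this
    simp at this
  obtain ⟨s, hs⟩ := Polynomial.exists_eval_ne_zero_of_natDegree_lt_card (M.det * Polynomial.X)
    (mul_ne_zero hM0 Polynomial.X_ne_zero) (lt_of_lt_of_le (Cardinal.natCast_lt_aleph0)
      (Cardinal.aleph0_le_mk K))
  rw [Polynomial.eval_mul, Polynomial.eval_X, mul_ne_zero_iff] at hs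
  refine ⟨s, hs.2, ?_⟩
  have hd : Disjoint (LinearMap.ker (T s)) C := by
    rw [Submodule.disjoint_def]
    intro x hx hxC
    have h1 : (LinearMap.toMatrix b b (N ∘ₗ (T s).domRestrict C)).mulVec
        (b.repr ⟨x, hxC⟩) = 0 := by
      rw [LinearMap.toMatrix_mulVec_repr]
      have : (T s) x = 0 := hx
      simp [this]
    have h2 := Matrix.eq_zero_of_mulVec_eq_zero (hM s ▸ hs.1) h1
    have h3 : b.repr ⟨x, hxC⟩ = 0 := by ext i; exact congrFun h2 i
    have h4 : (⟨x, hxC⟩ : C) = 0 := by simpa using h3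
    simpa using h4
  have h1 := Submodule.finrank_add_finrank_le_of_disjoint hd
  have h2 := Submodule.finrank_add_eq_of_isCompl hC
  omega

/-- coordinate scaling -/
noncomputable def scaleHom {K : Type*} [Field K] (u : Fin 2 → K) :
    MvPolynomial (Fin 2) K →ₐ[K] MvPolynomial (Fin 2) K :=
  MvPolynomial.aeval (fun i => C (u i) * X i)

theorem pderiv_scale {K : Type*} [Field K] (u : Fin 2 → K) (i : Fin 2)
    (f : MvPolynomial (Fin 2) K) :
    pderiv i (scaleHom u f) = u i • scaleHom u (pderiv i f) := by
  induction f using MvPolynomial.induction_on with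
  | C a => simp [scaleHom]
  | add p q hp hq => simp [hp, hq]
  | mul_X p j hp =>
    rw [map_mul, Derivation.leibniz, Derivation.leibniz, hp]
    have : scaleHom u (X j) = C (u j) * X j := by simp [scaleHom]
    simp only [map_add, smul_eq_mul, map_mul, this, pderiv_C_mul]
    by_cases hij : j = i
    · subst hij
      simp [MvPolynomial.smul_eq_C_mul]; ring
    · simp [pderiv_X_of_ne hij, MvPolynomial.smul_eq_C_mul]; ring

theorem pderiv_pow_scale {K : Type*} [Field K] (u : Fin 2 → K) (i : Fin 2) (k : ℕ)
    (f : MvPolynomial (Fin 2) K) :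
    ((pderiv i).toLinearMap ^ k : Module.End K _) (scaleHom u f)
      = u i ^ k • scaleHom u (((pderiv i).toLinearMap ^ k : Module.End K _) f) := by
  induction k with
  | zero => simp
  | succ k ih =>
    rw [pow_succ', Module.End.mul_apply, ih, Module.End.mul_apply]
    rw [map_smul, show ∀ g, (pderiv i).toLinearMap (scaleHom u g)
      = u i • scaleHom u ((pderiv i).toLinearMap g) from pderiv_scale u i, smul_smul, pow_succ]

theorem evalPt_scale {K : Type*} [Field K] (u : Fin 2 → K) (p : K × K)
    (f : MvPolynomial (Fin 2) K) :
    evalPt K p (scaleHom u f) = evalPt K (u 0 * p.1, u 1 * p.2) f := by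
  have : (MvPolynomial.aeval (fun i : Fin 2 => if i = 0 then p.1 else p.2)).comp (scaleHom u)
      = MvPolynomial.aeval (R := K)
        (fun i : Fin 2 => if i = 0 then u 0 * p.1 else u 1 * p.2) := by
    ext i
    fin_cases i <;> simp [scaleHom]
  exact DFunLike.congr_fun this f

theorem cond_scale {K : Type*} [Field K] (u : Fin 2 → K) (p : K × K) (β : ℕ × ℕ)
    (f : MvPolynomial (Fin 2) K)
    (h : evalPt K (u 0 * p.1, u 1 * p.2) (derivOp K β f) = 0) :
    evalPt K p (derivOp K β (scaleHom u f)) = 0 := by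
  rw [derivOp, Module.End.mul_apply] at h ⊢
  rw [pderiv_pow_scale, map_smul, pderiv_pow_scale, map_smul, map_smul, evalPt_scale, h]
  simp

/-- the exponent -/
noncomputable def ex (d : ℕ × ℕ) : Fin 2 →₀ ℕ :=
  Finsupp.single (0 : Fin 2) d.1 + Finsupp.single 1 d.2

theorem ex_inj : Function.Injective ex := by
  intro a b h
  have h0 := DFunLike.congr_fun h 0
  have h1 := DFunLike.congr_fun h 1
  simp [ex] at h0 h1
  exact Prod.ext h0 h1

theorem scale_mono {K : Type*} [Field K] (u : Fin 2 → K) (d : ℕ × ℕ) :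
    scaleHom u (monomial (ex d) (1 : K)) = (u 0 ^ d.1 * u 1 ^ d.2) • monomial (ex d) (1 : K) := by
  have : monomial (ex d) (1 : K) = X 0 ^ d.1 * X 1 ^ d.2 := by
    simp [ex, X_pow_eq_monomial, monomial_mul]
  rw [this]
  simp [scaleHom, MvPolynomial.smul_eq_C_mul]
  ring

/-- vanishing conditions -/
noncomputable def condSp (K : Type*) [Field K] {r : ℕ}
    (m : Fin r → ℕ) (p : Fin r → K × K) : Submodule K (MvPolynomial (Fin 2) K) :=
  ⨅ j : Fin r, ⨅ β : ℕ × ℕ, ⨅ _ : β.1 + β.2 < m j,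
    LinearMap.ker (evalPt K (p j) ∘ₗ derivOp K β)

theorem mem_condSp {K : Type*} [Field K] {r : ℕ}
    (m : Fin r → ℕ) (p : Fin r → K × K) (f : MvPolynomial (Fin 2) K) :
    f ∈ condSp K m p ↔ ∀ j, ∀ β : ℕ × ℕ, β.1 + β.2 < m j → evalPt K (p j) (derivOp K β f) = 0 := by
  simp [condSp, Submodule.mem_iInf]

theorem dimSys_attained (K : Type*) [Field K] (D : Finset (ℕ × ℕ)) {r : ℕ} (m : Fin r → ℕ) :
    ∃ p : Fin r → K × K, (Module.finrank K ↥(linSysPts K D m p) : ℤ) - 1 = dimSys K D m := by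
  have := Int.csInf_mem (s := Set.range fun p : Fin r → K × K =>
    (Module.finrank K ↥(linSysPts K D m p) : ℤ) - 1) (Set.range_nonempty _)
    ⟨-1, by rintro _ ⟨p, rfl⟩; dsimp only; omega⟩
  exact this

theorem dimSys_le (K : Type*) [Field K] (D : Finset (ℕ × ℕ)) {r : ℕ} (m : Fin r → ℕ)
    (p : Fin r → K × K) :
    dimSys K D m ≤ (Module.finrank K ↥(linSysPts K D m p) : ℤ) - 1 :=
  csInf_le ⟨-1, by rintro _ ⟨p, rfl⟩; dsimp only; omega⟩ ⟨p, rfl⟩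

theorem monoSpan_fd (K : Type*) [Field K] (D : Finset (ℕ × ℕ)) :
    FiniteDimensional K (monoSpan K D) :=
  FiniteDimensional.span_of_finite K (D.finite_toSet.image _)

theorem linSys_fd (K : Type*) [Field K] (D : Finset (ℕ × ℕ)) {r : ℕ} (m : Fin r → ℕ)
    (p : Fin r → K × K) : FiniteDimensional K (linSysPts K D m p) := by
  have := monoSpan_fd K D
  exact Submodule.finiteDimensional_of_le (inf_le_left : linSysPts K D m p ≤ monoSpan K D)

theorem core {K : Type*} [Field K] [Infinite K] (D A B : Finset (ℕ × ℕ)) (hA : A ⊆ D)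
    (hcov : ∀ α ∈ D, α ∉ A → α ∈ B) (hdis : ∀ α ∈ A, α ∉ B)
    {r q : ℕ} (m₁ : Fin r → ℕ) (m₂ : Fin q → ℕ) (a b : ℤ)
    (hab : ∀ α ∈ A, ∀ β ∈ B, a * (β.1 : ℤ) + b * β.2 < a * α.1 + b * α.2)
    (p₁ : Fin r → K × K) (p₂ : Fin q → K × K)
    (h2 : linSysPts K A m₂ p₂ = ⊥) :
    ∃ p, Module.finrank K (linSysPts K D (Fin.append m₁ m₂) p) ≤
      Module.finrank K (linSysPts K B m₁ p₁) := by
  classical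
  have hdisj : Disjoint (condSp K m₂ p₂) (monoSpan K A) := by
    rw [disjoint_comm, disjoint_iff]; exact h2
  obtain ⟨C, hle, hC⟩ := hdisj.exists_isCompl
  let N : MvPolynomial (Fin 2) K →ₗ[K] MvPolynomial (Fin 2) K :=
    (monoSpan K A).subtype ∘ₗ (monoSpan K A).projectionOnto C hC.symm
  have hN0 : ∀ f ∈ condSp K m₂ p₂, N f = 0 := by
    intro f hf
    have : (monoSpan K A).projectionOnto C hC.symm f = 0 := by
      rw [Submodule.projectionOnto_apply_eq_zero_iff]; exact hle hf
    simp [N, this]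
  have hN1 : ∀ α ∈ A, N (monomial (ex α) 1) = monomial (ex α) 1 := by
    intro α hα
    have hm : monomial (ex α) (1 : K) ∈ monoSpan K A :=
      Submodule.subset_span ⟨α, hα, rfl⟩
    have := Submodule.projectionOnto_apply_left hC.symm ⟨_, hm⟩
    simp only [N, LinearMap.comp_apply, this] 
    rfl
  let F : ℕ × ℕ → ℤ := fun α => a * α.1 + b * α.2
  let n : ℕ × ℕ → ℕ × ℕ → K := fun α β => coeff (ex α) (N (monomial (ex β) 1))
  have hn : ∀ α ∈ A, ∀ β ∈ A, n α β = if α = β then 1 else 0 := by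
    intro α _ β hβ
    simp only [n, hN1 β hβ, coeff_monomial, ex_inj.eq_iff, eq_comm]
  let v : D → MvPolynomial (Fin 2) K := fun α => monomial (ex α) 1
  let ι := Fintype.linearCombination K v
  have hι : ∀ c, ι c = ∑ α, c α • v α := fun c => Fintype.linearCombination_apply K v c
  have hcoef : ∀ c α, coeff (ex (α : D).1) (ι c) = c α := by
    intro c α
    simp [hι, v, coeff_sum, coeff_monomial, ex_inj.eq_iff, Subtype.coe_inj]
  have hιinj : Function.Injective ι := by
    intro c d h; ext α; rw [← hcoef c, h, hcoef]
  have hιr : monoSpan K D ≤ LinearMap.range ι := by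
    rw [monoSpan, Submodule.span_le]
    rintro _ ⟨d, hd, rfl⟩
    refine ⟨Pi.single ⟨d, hd⟩ 1, ?_⟩
    simp [hι, Pi.single_apply, v, ex]
  let T2 : K → (D → K) →ₗ[K] (A → K) := fun s =>
    (Matrix.of fun (α : A) (β : D) => n α β * s ^ (F α - F β).toNat).mulVecLin
  let T : K → (D → K) →ₗ[K] ((MvPolynomial (Fin 2) K ⧸ condSp K m₁ p₁) × (A → K)) := fun s =>
    ((condSp K m₁ p₁).mkQ ∘ₗ ι).prod (T2 s)
  have hT2 : ∀ s c α, T2 s c α = ∑ β : D, n α β * s ^ (F α - F β).toNat * c β := by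
    intro s c α; simp [T2, Matrix.mulVec, dotProduct]
  obtain ⟨s, hs, hfr⟩ := semicont_aux T (by
    intro φ c
    refine ⟨Polynomial.C (φ ((condSp K m₁ p₁).mkQ (ι c), 0)) + ∑ α : A,
      (∑ β : D, Polynomial.C (n α β * c β) * Polynomial.X ^ (F α - F β).toNat) *
        Polynomial.C (φ (0, Pi.single α 1)), fun s => ?_⟩
    have e : T s c = ((condSp K m₁ p₁).mkQ (ι c), 0) + ∑ α : A, T2 s c α • (0, Pi.single α 1) := by
      ext1
      · simp [T, Prod.fst_sum]
      · ext α
        simp [T, Prod.snd_sum, Finset.sum_apply, Pi.single_apply]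
    rw [e]
    simp only [map_add, map_sum, map_smul, Polynomial.eval_add, Polynomial.eval_finsetSum,
      Polynomial.eval_mul, Polynomial.eval_C, Polynomial.eval_pow, Polynomial.eval_X, hT2,
      smul_eq_mul]
    congr 1
    refine Finset.sum_congr rfl fun α _ => ?_
    congr 1
    refine Finset.sum_congr rfl fun β _ => ?_
    ring)
  let u : Fin 2 → K := ![s ^ (-a), s ^ (-b)]
  let p := Fin.append p₁ (fun j => (u 0 * (p₂ j).1, u 1 * (p₂ j).2))
  refine ⟨p, ?_⟩
  -- first inequality
  have hfd := linSys_fd K B m₁ p₁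
  set L := linSysPts K D (Fin.append m₁ m₂) p with hL
  have hmap : L = (L.comap ι).map ι := by
    have hLr : L ≤ LinearMap.range ι := (inf_le_left : L ≤ monoSpan K D).trans hιr
    rw [Submodule.map_comap_eq]
    exact (inf_eq_right.mpr hLr).symm
  have hLk : L.comap ι ≤ LinearMap.ker (T s) := by
    intro c hc
    have hc2 : ι c ∈ condSp K (Fin.append m₁ m₂) p := hc.2
    rw [mem_condSp] at hc2
    have h1 : ι c ∈ condSp K m₁ p₁ := by
      rw [mem_condSp]
      intro j β hβ
      simpa [p] using hc2 (Fin.castAdd q j) β (by simpa using hβ)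
    have h3 : scaleHom u (ι c) ∈ condSp K m₂ p₂ := by
      rw [mem_condSp]
      intro j β hβ
      apply cond_scale
      simpa [p] using hc2 (Fin.natAdd r j) β (by simpa using hβ)
    have h4 := hN0 _ h3
    have hu : ∀ d : ℕ × ℕ, u 0 ^ d.1 * u 1 ^ d.2 = s ^ (-F d) := by
      intro d
      simp only [u, F, Matrix.cons_val_zero, Matrix.cons_val_one]
      rw [← zpow_natCast, ← zpow_natCast, ← zpow_mul, ← zpow_mul, ← zpow_add₀ hs]
      congr 1; ring
    have h5 : ∀ α : A, ∑ β : D, c β * (s ^ (-F β) * n α β) = 0 := by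
      intro α
      have := congrArg (coeff (ex α)) h4
      simpa only [hι, map_sum, map_smul, v, scale_mono, hu, coeff_sum, coeff_smul, smul_eq_mul,
        coeff_zero] using this
    rw [LinearMap.mem_ker]
    refine Prod.ext ?_ ?_
    · simpa [T] using h1
    · funext α
      change T2 s c α = 0
      rw [hT2, ← mul_zero (s ^ F α), ← h5 α, Finset.mul_sum]
      refine Finset.sum_congr rfl fun β _ => ?_
      by_cases hnz : n α β = 0
      · simp [hnz]
      have hnn : 0 ≤ F α - F β := by
        by_cases hβ : (β : ℕ × ℕ) ∈ A
        · rw [hn α α.2 β hβ] at hnz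
          have : (α : ℕ × ℕ) = β := by by_contra h; simp [h] at hnz
          rw [this]; simp
        · have := hab α α.2 β (hcov β β.2 hβ)
          simp only [F]; linarith
      have : s ^ (F α - F β).toNat = s ^ F α * s ^ (-F β) := by
        rw [← zpow_add₀ hs, ← zpow_natCast, Int.toNat_of_nonneg hnn, sub_eq_add_neg]
      rw [this]; ring
  have hker0 : (LinearMap.ker (T 0)).map ι ≤ linSysPts K B m₁ p₁ := by
    rintro _ ⟨c, hc, rfl⟩
    have hc0 : T 0 c = 0 := hc
    have h1 : ι c ∈ condSp K m₁ p₁ := by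
      have := congrArg Prod.fst hc0
      simpa [T] using this
    have h3 : ∀ α : A, c ⟨α, hA α.2⟩ = 0 := by
      intro α
      have h4 : T2 0 c α = 0 := congrFun (congrArg Prod.snd hc0) α
      rw [hT2, Finset.sum_eq_single ⟨α, hA α.2⟩] at h4
      · simpa [hn α α.2 α α.2] using h4
      · intro β _ hβ
        by_cases hβA : (β : ℕ × ℕ) ∈ A
        · rw [hn α α.2 β hβA, if_neg]
          · simp
          · intro h; exact hβ (Subtype.ext h.symm)
        · have := hab α α.2 β (hcov β β.2 hβA)
          have : (F α - F β).toNat ≠ 0 := by simp only [F]; omega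
          simp [this]
      · simp
    refine ⟨?_, h1⟩
    change ι c ∈ monoSpan K B
    rw [hι]
    refine Submodule.sum_mem _ fun α _ => ?_
    by_cases hα : (α : ℕ × ℕ) ∈ A
    · have := h3 ⟨α, hα⟩
      simp only [Subtype.coe_eta] at this
      simp [this]
    · exact Submodule.smul_mem _ _ (Submodule.subset_span ⟨α, hcov α α.2 hα, rfl⟩)
  calc Module.finrank K L = Module.finrank K ((L.comap ι).map ι) := by rw [← hmap]
    _ ≤ Module.finrank K (L.comap ι) := Submodule.finrank_map_le _ _
    _ ≤ Module.finrank K (LinearMap.ker (T s)) := Submodule.finrank_mono hLk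
    _ ≤ Module.finrank K (LinearMap.ker (T 0)) := hfr
    _ = Module.finrank K ((LinearMap.ker (T 0)).map ι) :=
        ((LinearMap.ker (T 0)).equivMapOfInjective ι hιinj).finrank_eq
    _ ≤ _ := Submodule.finrank_mono hker0

/-- **Diagram cutting.** Let `m₁,…,m_r,m_{r+1},…,m_p` be positive integers,
`D` a diagram, and `F(α) = r₁α₁ + r₂α₂ + r₀` an affine function not vanishing on `D`.
Set `D₁ := {α ∈ D : F(α) < 0}` and `D₂ := {α ∈ D : F(α) > 0}`.  If the system
`L₂ = L_{D₂}(m_{r+1},…,m_p)` is non-special with `vdim L₂ = −1`, then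
`dim L_D(m₁,…,m_p) ≤ dim L_{D₁}(m₁,…,m_r)`. -/
theorem statement4 {K : Type*} [Field K] [CharZero K]
    (D : Finset (ℕ × ℕ)) {r q : ℕ}
    (m₁ : Fin r → ℕ) (m₂ : Fin q → ℕ) (hm₁ : ∀ j, 0 < m₁ j) (hm₂ : ∀ j, 0 < m₂ j)
    (r₀ r₁ r₂ : ℝ)
    (hF : ∀ α ∈ D, r₁ * (α.1 : ℝ) + r₂ * (α.2 : ℝ) + r₀ ≠ 0)
    (hns : nonSpecial K
      (D.filter fun α => 0 < r₁ * (α.1 : ℝ) + r₂ * (α.2 : ℝ) + r₀) m₂)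
    (hv : vdimSys
      (D.filter fun α => 0 < r₁ * (α.1 : ℝ) + r₂ * (α.2 : ℝ) + r₀) m₂ = -1) :
    dimSys K D (Fin.append m₁ m₂) ≤
      dimSys K (D.filter fun α => r₁ * (α.1 : ℝ) + r₂ * (α.2 : ℝ) + r₀ < 0) m₁ := by
  have := CharZero.infinite K
  obtain ⟨p₂, hp₂⟩ := dimSys_attained K
    (D.filter fun α => 0 < r₁ * (α.1 : ℝ) + r₂ * (α.2 : ℝ) + r₀) m₂
  obtain ⟨p₁, hp₁⟩ := dimSys_attained K
    (D.filter fun α => r₁ * (α.1 : ℝ) + r₂ * (α.2 : ℝ) + r₀ < 0) m₁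
  rw [nonSpecial, hv, max_self] at hns
  rw [hns] at hp₂
  have hfd := linSys_fd K
    (D.filter fun α => 0 < r₁ * (α.1 : ℝ) + r₂ * (α.2 : ℝ) + r₀) m₂ p₂
  have h2 := Submodule.finrank_eq_zero.mp
    (show Module.finrank K (linSysPts K
      (D.filter fun α => 0 < r₁ * (α.1 : ℝ) + r₂ * (α.2 : ℝ) + r₀) m₂ p₂) = 0 by omega)
  obtain ⟨a, b, hab⟩ := perturb_aux
    (D.filter fun α => 0 < r₁ * (α.1 : ℝ) + r₂ * (α.2 : ℝ) + r₀)
    (D.filter fun α => r₁ * (α.1 : ℝ) + r₂ * (α.2 : ℝ) + r₀ < 0) r₁ r₂ (by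
      intro α hα β hβ
      have h1 := (Finset.mem_filter.mp hα).2
      have h2 := (Finset.mem_filter.mp hβ).2
      linarith)
  obtain ⟨p, hp⟩ := core D _ _ (Finset.filter_subset _ _) (by
      intro α hα h
      rw [Finset.mem_filter] at h ⊢
      refine ⟨hα, lt_of_le_of_ne (not_lt.mp fun h' => h ⟨hα, h'⟩) (hF α hα)⟩) (by
      intro α hα hβ
      have h1 := (Finset.mem_filter.mp hα).2
      have h2 := (Finset.mem_filter.mp hβ).2
      linarith) m₁ m₂ a b hab p₁ p₂ h2
  have := dimSys_le K D (Fin.append m₁ m₂) p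
  omega
end

section
/- Let m be a positive integer and let D = (1^{↑m−1},2^{↑m−2},…,(m−1)^{↑1},m^{↑0}), i.e., D = {(i,j) ∈ ℕ² : i ≤ m−1, j ≤ m−1, i+j ≥ m−1}. Then the system L_D(m) (one base point of multiplicity m) is non-special and vdim L_D(m) = −1. -/
open MvPolynomial

noncomputable def VV (K : Type*) [Field K] (n : ℕ) : Submodule K (ℕ × ℕ → K) :=
  Submodule.span K {g | ∃ β : ℕ × ℕ, β.1 + β.2 ≤ n ∧
    g = fun d => ((d.1.descFactorial β.1 : ℕ) : K) * ((d.2.descFactorial β.2 : ℕ) : K)}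

lemma mul_desc (K : Type*) [Field K] (i b : ℕ) :
    (i : K) * (i.descFactorial b : ℕ) = (i.descFactorial (b+1) : ℕ) + (b : K) * (i.descFactorial b : ℕ) := by
  rw [Nat.descFactorial_succ]
  rcases le_or_gt b i with h | h
  · push_cast [h]; ring
  · simp [Nat.descFactorial_of_lt h]

lemma VV_lin (K : Type*) [Field K] (n : ℕ) (a b c : K) (g : ℕ × ℕ → K) (hg : g ∈ VV K n) :
    (fun d : ℕ × ℕ => (a * d.1 + b * d.2 + c) * g d) ∈ VV K (n+1) := by
  unfold VV at hg
  induction hg using Submodule.span_induction with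
  | mem x hx =>
    obtain ⟨β, hβ, rfl⟩ := hx
    have gen : ∀ γ : ℕ × ℕ, γ.1 + γ.2 ≤ n + 1 →
      (fun d : ℕ × ℕ => ((d.1.descFactorial γ.1 : ℕ) : K) * ((d.2.descFactorial γ.2 : ℕ) : K)) ∈ VV K (n+1) :=
      fun γ hγ => Submodule.subset_span ⟨γ, hγ, rfl⟩
    have h1 := gen (β.1+1, β.2) (by simp; omega)
    have h2 := gen (β.1, β.2+1) (by simp; omega)
    have h3 := gen β (by omega)
    convert (VV K (n+1)).add_mem ((VV K (n+1)).add_mem ((VV K (n+1)).smul_mem a h1)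
      ((VV K (n+1)).smul_mem b h2)) ((VV K (n+1)).smul_mem (a * β.1 + b * β.2 + c) h3) using 1
    funext d
    simp only [Pi.add_apply, Pi.smul_apply, smul_eq_mul]
    linear_combination (a * (d.2.descFactorial β.2 : ℕ)) * mul_desc K d.1 β.1 +
      (b * (d.1.descFactorial β.1 : ℕ)) * mul_desc K d.2 β.2
  | zero =>
    convert (VV K (n+1)).zero_mem using 1
    funext d; simp
  | add x y _ _ hx hy =>
    convert (VV K (n+1)).add_mem hx hy using 1
    funext d; simp [mul_add]
  | smul t x _ hx =>
    convert (VV K (n+1)).smul_mem t hx using 1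
    funext d; simp; ring

lemma VV_prod (K : Type*) [Field K] (n : ℕ) (a b : K) (g : ℕ × ℕ → K) (hg : g ∈ VV K n)
    (s : Finset ℕ) :
    (fun d : ℕ × ℕ => (∏ k ∈ s, (a * d.1 + b * d.2 - (k : K))) * g d) ∈ VV K (n + s.card) := by
  classical
  induction s using Finset.induction_on with
  | empty => simpa using hg
  | insert k s hk ih =>
    rw [Finset.card_insert_of_notMem hk, ← add_assoc]
    convert VV_lin K _ a b (-(k:K)) _ ih using 1
    funext d
    rw [Finset.prod_insert hk]; ring

lemma VV_one (K : Type*) [Field K] : (fun _ : ℕ × ℕ => (1 : K)) ∈ VV K 0 :=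
  Submodule.subset_span ⟨(0, 0), by simp, by simp⟩

lemma pd0 (K : Type*) [Field K] (k a b : ℕ) (r : K) :
    ((pderiv (0 : Fin 2)).toLinearMap ^ k : Module.End K (MvPolynomial (Fin 2) K))
      (monomial (Finsupp.single (0 : Fin 2) a + Finsupp.single 1 b) r) =
    monomial (Finsupp.single (0 : Fin 2) (a - k) + Finsupp.single 1 b) (r * (a.descFactorial k : ℕ)) := by
  induction k with
  | zero => simp
  | succ k ih =>
    rw [pow_succ', Module.End.mul_apply, ih]
    refine (pderiv_monomial (R := K)).trans ?_
    congr 1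
    · congr 1
      ext i; fin_cases i <;> simp <;> omega
    · rw [Nat.descFactorial_succ]; simp; ring

lemma pd1 (K : Type*) [Field K] (k a b : ℕ) (r : K) :
    ((pderiv (1 : Fin 2)).toLinearMap ^ k : Module.End K (MvPolynomial (Fin 2) K))
      (monomial (Finsupp.single (0 : Fin 2) a + Finsupp.single 1 b) r) =
    monomial (Finsupp.single (0 : Fin 2) a + Finsupp.single 1 (b - k)) (r * (b.descFactorial k : ℕ)) := by
  induction k with
  | zero => simp
  | succ k ih =>
    rw [pow_succ', Module.End.mul_apply, ih]
    refine (pderiv_monomial (R := K)).trans ?_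
    congr 1
    · congr 1
      ext i; fin_cases i <;> simp <;> omega
    · rw [Nat.descFactorial_succ]; simp; ring

lemma ev_deriv (K : Type*) [Field K] (β d : ℕ × ℕ) :
    (evalPt K (1, 1) ∘ₗ derivOp K β)
      (monomial (Finsupp.single (0 : Fin 2) d.1 + Finsupp.single 1 d.2) (1 : K)) =
    ((d.1.descFactorial β.1 : ℕ) : K) * ((d.2.descFactorial β.2 : ℕ) : K) := by
  rw [LinearMap.comp_apply, derivOp, Module.End.mul_apply, pd1, pd0, evalPt]
  simp [aeval_monomial, mul_comm]

lemma linSys_bot (K : Type*) [Field K] [CharZero K] (m : ℕ) (hm : 0 < m) :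
    linSysPts K ((Finset.range m ×ˢ Finset.range m).filter fun d => m - 1 ≤ d.1 + d.2)
        (fun _ : Fin 1 => m) (fun _ => (1, 1)) = ⊥ := by
  classical
  rw [eq_bot_iff]
  intro f hf
  obtain ⟨hf1, hf2⟩ := Submodule.mem_inf.1 hf
  simp only [Submodule.mem_iInf] at hf2
  rw [monoSpan, Submodule.mem_span_image_finset_iff_exists_fun] at hf1
  set D := (Finset.range m ×ˢ Finset.range m).filter fun d => m - 1 ≤ d.1 + d.2 with hD
  have hf3 : ∃ c : ℕ × ℕ → K, ∑ d ∈ D, c d •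
      (monomial (Finsupp.single (0 : Fin 2) d.1 + Finsupp.single 1 d.2) (1 : K)) = f := by
    obtain ⟨c, hc⟩ := hf1
    refine ⟨fun d => if h : d ∈ D then c ⟨d, h⟩ else 0, ?_⟩
    rw [← hc, ← Finset.sum_coe_sort]
    refine Finset.sum_congr rfl fun d _ => ?_
    simp
  obtain ⟨c, rfl⟩ := hf3
  have key : ∀ g ∈ VV K (m-1), ∑ d ∈ D, c d * g d = 0 := by
    intro g hg
    unfold VV at hg
    induction hg using Submodule.span_induction with
    | mem x hx =>
      obtain ⟨β, hβ, rfl⟩ := hx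
      have := hf2 0 β (by omega)
      rw [LinearMap.mem_ker, map_sum] at this
      simpa only [map_smul, ev_deriv, smul_eq_mul] using this
    | zero => simp
    | add x y _ _ hx hy => simp [mul_add, Finset.sum_add_distrib, hx, hy]
    | smul t x _ hx =>
      simp only [Pi.smul_apply, smul_eq_mul, mul_left_comm _ t, ← Finset.mul_sum, hx, mul_zero]
  rw [Submodule.mem_bot]
  refine Finset.sum_eq_zero fun e he => ?_
  have he' := he
  simp only [hD, Finset.mem_filter, Finset.mem_product, Finset.mem_range] at he'
  have h := VV_prod K _ 1 1 _ (VV_prod K _ 0 1 _ (VV_prod K _ 1 0 _ (VV_one K)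
    (Finset.Ico (e.1+1) m)) (Finset.Ico (e.2+1) m)) (Finset.Ico (m-1) (e.1+e.2))
  simp only [Nat.card_Ico] at h
  rw [show 0 + (m - (e.1+1)) + (m - (e.2+1)) + (e.1 + e.2 - (m-1)) = m - 1 by omega] at h
  have h2 := key _ h
  rw [Finset.sum_eq_single_of_mem e he] at h2
  · have : c e = 0 := by
      refine (mul_eq_zero.1 h2).resolve_right ?_
      simp only [mul_one, one_mul, zero_mul, add_zero, zero_add]
      refine mul_ne_zero ?_ (mul_ne_zero ?_ ?_) <;>
      · refine Finset.prod_ne_zero_iff.2 fun k hk => ?_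
        rw [Finset.mem_Ico] at hk
        rw [sub_ne_zero]
        norm_cast
        omega
    simp [this]
  · intro d hd hde
    simp only [hD, Finset.mem_filter, Finset.mem_product, Finset.mem_range] at hd
    have hne : ¬ (d.1 = e.1 ∧ d.2 = e.2) := fun h => hde (Prod.ext h.1 h.2)
    simp only [mul_one, one_mul, zero_mul, add_zero, zero_add]
    by_cases h1 : e.1 < d.1
    · rw [Finset.prod_eq_zero (s := Finset.Ico (e.1+1) m) (i := d.1) (by simp; omega) (by simp)]
      simp
    by_cases h3 : e.2 < d.2
    · rw [Finset.prod_eq_zero (s := Finset.Ico (e.2+1) m) (i := d.2) (by simp; omega) (by simp)]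
      simp
    rw [Finset.prod_eq_zero (s := Finset.Ico (m-1) (e.1+e.2)) (i := d.1 + d.2)
      (by simp; omega) (by simp)]
    simp

lemma D_card (m : ℕ) :
    ((Finset.range m ×ˢ Finset.range m).filter fun d => m - 1 ≤ d.1 + d.2).card
      = (m + 1).choose 2 := by
  rw [Finset.card_filter, Finset.sum_product]
  have h : ∀ i ∈ Finset.range m,
      (∑ j ∈ Finset.range m, if m - 1 ≤ i + j then 1 else 0) = i + 1 := by
    intro i hi
    rw [Finset.mem_range] at hi
    rw [← Finset.card_filter]
    have : (Finset.range m).filter (fun j => m - 1 ≤ i + j) = Finset.Ico (m - 1 - i) m := by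
      ext j; simp; omega
    rw [this, Nat.card_Ico]; omega
  rw [Finset.sum_congr rfl h]
  clear h
  induction m with
  | zero => simp
  | succ n ih => rw [Finset.sum_range_succ, ih, Nat.choose_succ_succ' (n+1) 1]; simp; ring

/-- Let `m ≥ 1` and
`D = (1^{↑m−1}, 2^{↑m−2}, …, (m−1)^{↑1}, m^{↑0}) = {(i,j) : i ≤ m−1, j ≤ m−1, i+j ≥ m−1}`.
Then `L_D(m)` is non-special and `vdim L_D(m) = −1`. -/
theorem statement6 {K : Type*} [Field K] [CharZero K] (m : ℕ) (hm : 0 < m) :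
    nonSpecial K
        ((Finset.range m ×ˢ Finset.range m).filter fun d => m - 1 ≤ d.1 + d.2)
        (fun _ : Fin 1 => m) ∧
      vdimSys ((Finset.range m ×ˢ Finset.range m).filter fun d => m - 1 ≤ d.1 + d.2)
        (fun _ : Fin 1 => m) = -1 := by
  have hv : vdimSys ((Finset.range m ×ˢ Finset.range m).filter fun d => m - 1 ≤ d.1 + d.2)
        (fun _ : Fin 1 => m) = -1 := by
    rw [vdimSys, D_card]; simp
  refine ⟨?_, hv⟩
  rw [nonSpecial, hv, max_self, dimSys]
  refine IsLeast.csInf_eq ⟨⟨fun _ => (1, 1), ?_⟩, ?_⟩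
  · dsimp only
    rw [linSys_bot K m hm]; simp
  · rintro _ ⟨p, rfl⟩
    dsimp only
    omega
end

section
/- Let m be a positive integer and let D = (m^{↑m},m^{↑m−1},…,m^{↑0}), i.e., D = {(i,j) ∈ ℕ² : 0 ≤ i ≤ m, m−i ≤ j ≤ 2m−1−i}. Then the system L_D(m^{×2}) (two base points, each of multiplicity m) is non-special and vdim L_D(m^{×2}) = −1. -/
open MvPolynomial

lemma coeff_pd {K : Type*} [Field K] (i : Fin 2) (F : MvPolynomial (Fin 2) K) (s : Fin 2 →₀ ℕ) :
    coeff s (pderiv i F) = coeff (s + Finsupp.single i 1) F * ((s i : K) + 1) := by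
  classical
  induction F using MvPolynomial.induction_on' with
  | add p q hp hq => simp only [map_add, coeff_add, hp, hq, add_mul]
  | monomial u a =>
    rw [pderiv_monomial, coeff_monomial, coeff_monomial]
    by_cases h : u = s + Finsupp.single i 1
    · subst h
      simp
    · rw [if_neg h]
      split_ifs with h2
      · by_cases h3 : u i = 0
        · simp [h3]
        · exfalso
          apply h
          rw [← h2]
          ext j
          by_cases hj : j = i
          · subst hj; simp; omega
          · simp [Ne.symm hj]
      · simp

lemma coeff_pd_pow {K : Type*} [Field K] [CharZero K] (i : Fin 2) (n : ℕ) :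
    ∀ (s : Fin 2 →₀ ℕ), ∃ c : K, c ≠ 0 ∧ ∀ (F : MvPolynomial (Fin 2) K),
    coeff s (((pderiv i).toLinearMap ^ n : Module.End K (MvPolynomial (Fin 2) K)) F)
      = coeff (s + Finsupp.single i n) F * c := by
  induction n with
  | zero => intro s; exact ⟨1, one_ne_zero, fun F => by simp⟩
  | succ n ih =>
    intro s
    obtain ⟨c, hc, h⟩ := ih (s + Finsupp.single i 1)
    refine ⟨c * ((s i : K) + 1), mul_ne_zero hc (Nat.cast_add_one_ne_zero _), fun F => ?_⟩
    rw [pow_succ', Module.End.mul_apply]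
    rw [Derivation.coeFn_coe, coeff_pd, h, add_assoc, ← Finsupp.single_add, add_comm 1 n, mul_assoc]

noncomputable def shiftPt (K : Type*) [Field K] (p : K × K) :
    MvPolynomial (Fin 2) K →ₐ[K] MvPolynomial (Fin 2) K :=
  aeval (fun i : Fin 2 => X i + C (if i = 0 then p.1 else p.2))

lemma shift_pd {K : Type*} [Field K] (p : K × K) (i : Fin 2) (F : MvPolynomial (Fin 2) K) :
    pderiv i (shiftPt K p F) = shiftPt K p (pderiv i F) := by
  classical
  induction F using MvPolynomial.induction_on with
  | C a => simp [shiftPt]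
  | add p q hp hq => simp only [map_add, hp, hq]
  | mul_X q j hq =>
    rw [map_mul, Derivation.leibniz, Derivation.leibniz, hq]
    simp only [smul_eq_mul, map_add, map_mul]
    congr 2
    simp only [shiftPt, aeval_X, map_add, pderiv_X, pderiv_C, add_zero]
    rw [Pi.single_apply]
    split_ifs <;> simp

lemma shift_pd_pow {K : Type*} [Field K] (p : K × K) (i : Fin 2) (n : ℕ)
    (F : MvPolynomial (Fin 2) K) :
    ((pderiv i).toLinearMap ^ n : Module.End K (MvPolynomial (Fin 2) K)) (shiftPt K p F)
     = shiftPt K p (((pderiv i).toLinearMap ^ n : Module.End K (MvPolynomial (Fin 2) K)) F) := by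
  induction n with
  | zero => simp
  | succ n ih =>
    rw [pow_succ', Module.End.mul_apply, Module.End.mul_apply, ih]
    exact shift_pd p i _

lemma coeff_zero_shift {K : Type*} [Field K] (p : K × K) (F : MvPolynomial (Fin 2) K) :
    coeff 0 (shiftPt K p F) = evalPt K p F := by
  rw [← constantCoeff_eq]
  induction F using MvPolynomial.induction_on with
  | C a => simp [shiftPt, evalPt]
  | add p q hp hq => simp only [map_add, hp, hq]
  | mul_X q j hq =>
    rw [map_mul, map_mul, hq]
    simp [shiftPt, evalPt]

lemma coeff_shift {K : Type*} [Field K] [CharZero K] (p : K × K) (F : MvPolynomial (Fin 2) K)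
    (a b : ℕ) (h : evalPt K p (derivOp K (a, b) F) = 0) :
    coeff (Finsupp.single 0 a + Finsupp.single 1 b) (shiftPt K p F) = 0 := by
  rw [← coeff_zero_shift, derivOp, Module.End.mul_apply, ← shift_pd_pow, ← shift_pd_pow] at h
  obtain ⟨c, hc, h1⟩ := coeff_pd_pow (K := K) (0 : Fin 2) a 0
  obtain ⟨e, he, h2⟩ := coeff_pd_pow (K := K) (1 : Fin 2) b (0 + Finsupp.single 0 a)
  simp only [h1, h2] at h
  simpa [hc, he] using h

lemma taylor_mem {K : Type*} [Field K] [CharZero K] (p : K × K) (F : MvPolynomial (Fin 2) K)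
    (m : ℕ) (h : ∀ β : ℕ × ℕ, β.1 + β.2 < m → evalPt K p (derivOp K β F) = 0)
    {A : Type*} [CommRing A] [Algebra K A] (J : Ideal A) (x y : A)
    (hx : x - algebraMap K A p.1 ∈ J) (hy : y - algebraMap K A p.2 ∈ J) :
    aeval (fun i : Fin 2 => if i = 0 then x else y) F ∈ J ^ m := by
  have h1 : aeval (fun i : Fin 2 => if i = 0 then x else y) F =
      aeval (fun i : Fin 2 => if i = 0 then x - algebraMap K A p.1 else y - algebraMap K A p.2)
        (shiftPt K p F) := by
    rw [← AlgHom.comp_apply]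
    congr 1
    apply MvPolynomial.algHom_ext
    intro i
    fin_cases i <;> simp [shiftPt]
  rw [h1, MvPolynomial.aeval_def, MvPolynomial.eval₂_eq']
  apply Ideal.sum_mem
  intro s hs
  apply Ideal.mul_mem_left
  have hs' : s = Finsupp.single 0 (s 0) + Finsupp.single 1 (s 1) := by
    ext j; fin_cases j <;> simp
  have hm : m ≤ s 0 + s 1 := by
    by_contra hlt
    push Not at hlt
    rw [MvPolynomial.mem_support_iff] at hs
    apply hs
    rw [hs']
    exact coeff_shift p F _ _ (h (s 0, s 1) hlt)
  apply Ideal.pow_le_pow_right hm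
  rw [Fin.prod_univ_two, pow_add]
  exact Ideal.mul_mem_mul (Ideal.pow_mem_pow (by simpa using hx) _)
    (Ideal.pow_mem_pow (by simpa using hy) _)

noncomputable def Gpoly {K : Type*} [Field K] (m : ℕ) (D : Finset (ℕ × ℕ)) (c : ℕ × ℕ → K)
    (d : K) : Polynomial K :=
  ∑ s ∈ D, Polynomial.C (c s) * ((Polynomial.X * (Polynomial.X + Polynomial.C d)) ^ s.1 *
    (Polynomial.C d * Polynomial.X + 1) ^ (m - s.1) * Polynomial.X ^ s.2)

noncomputable def Fpoly {K : Type*} [Field K] (D : Finset (ℕ × ℕ)) (c : ℕ × ℕ → K) :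
    MvPolynomial (Fin 2) K :=
  ∑ s ∈ D, c s • (monomial (Finsupp.single (0 : Fin 2) s.1 + Finsupp.single 1 s.2) (1 : K))

lemma aeval_Fpoly {K : Type*} [Field K] (D : Finset (ℕ × ℕ)) (c : ℕ × ℕ → K)
    {A : Type*} [CommRing A] [Algebra K A] (x y : A) :
    aeval (fun i : Fin 2 => if i = 0 then x else y) (Fpoly D c) =
      ∑ s ∈ D, algebraMap K A (c s) * (x ^ s.1 * y ^ s.2) := by
  rw [Fpoly, map_sum]
  refine Finset.sum_congr rfl fun s _ => ?_
  rw [map_smul, MvPolynomial.aeval_monomial, Finsupp.prod_fintype _ _ (by simp),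
    Fin.prod_univ_two, Algebra.smul_def]
  simp

lemma Gpoly_dvd {K : Type*} [Field K] [CharZero K] (m : ℕ) (hm : 0 < m) (D : Finset (ℕ × ℕ))
    (hD : ∀ s ∈ D, s.1 ≤ m) (c : ℕ × ℕ → K) (d y0 : K) (hy : y0 ^ 2 = 1) (hd : d * y0 + 1 ≠ 0)
    (h : ∀ β : ℕ × ℕ, β.1 + β.2 < m → evalPt K (1, y0) (derivOp K β (Fpoly D c)) = 0) :
    (Polynomial.X - Polynomial.C y0) ^ m ∣ Gpoly m D c d := by
  obtain ⟨u, v, huv⟩ : IsCoprime (Polynomial.C d * Polynomial.X + 1 : Polynomial K)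
      ((Polynomial.X - Polynomial.C y0) ^ m) := by
    apply IsCoprime.pow_right
    refine ⟨Polynomial.C (d * y0 + 1)⁻¹, - Polynomial.C ((d * y0 + 1)⁻¹ * d), ?_⟩
    have : Polynomial.C (d * y0 + 1)⁻¹ * (Polynomial.C d * Polynomial.C y0 + 1)
        = (1 : Polynomial K) := by
      rw [← Polynomial.C_mul, ← Polynomial.C_1, ← Polynomial.C_add, ← Polynomial.C_mul,
        inv_mul_cancel₀ hd]
    rw [Polynomial.C_mul]
    linear_combination this
  set T := (Polynomial.X : Polynomial K) with hT
  set Y := (Polynomial.C y0 : Polynomial K) with hY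
  set Dd := (Polynomial.C d : Polynomial K) with hDd
  have hYY : Y ^ 2 = 1 := by rw [hY, ← Polynomial.C_pow, hy, Polynomial.C_1]
  have h1 := taylor_mem (1, y0) (Fpoly D c) m h (Ideal.span {T - Y})
    (T * (T + Dd) * u) T
    (by
      rw [Ideal.mem_span_singleton]
      have e : T * (T + Dd) * u - algebraMap K (Polynomial K) (1, y0).1 =
          (T - Y) * (u * (T + Y) ) - v * (T - Y) ^ m := by
        simp only [map_one]
        linear_combination huv + u * hYY
      rw [e]
      exact dvd_sub (dvd_mul_right _ _) (Dvd.dvd.mul_left (dvd_pow_self _ hm.ne') _))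
    (by rw [Ideal.mem_span_singleton]; exact dvd_rfl)
  rw [Ideal.span_singleton_pow, Ideal.mem_span_singleton, aeval_Fpoly] at h1
  have h2 : (T - Y) ^ m ∣ Gpoly m D c d - (Dd * T + 1) ^ m *
      ∑ s ∈ D, algebraMap K (Polynomial K) (c s) * ((T * (T + Dd) * u) ^ s.1 * T ^ s.2) := by
    rw [Gpoly, Finset.mul_sum, ← Finset.sum_sub_distrib]
    apply Finset.dvd_sum
    intro s hs
    obtain ⟨k, hk⟩ := Nat.exists_eq_add_of_le (hD s hs)
    have e2 : m - s.1 = k := by omega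
    have e3 : (Dd * T + 1) ^ m = (Dd * T + 1) ^ s.1 * (Dd * T + 1) ^ k := by
      rw [← pow_add, ← hk]
    rw [e2, e3]
    have e4 : (T - Y) ^ m ∣ (1 : Polynomial K) ^ s.1 - (u * (Dd * T + 1)) ^ s.1 :=
      Dvd.dvd.trans ⟨v, by linear_combination -huv⟩ (sub_dvd_pow_sub_pow _ _ _)
    have e5 : Polynomial.C (c s) * ((T * (T + Dd)) ^ s.1 * (Dd * T + 1) ^ k * T ^ s.2) -
        (Dd * T + 1) ^ s.1 * (Dd * T + 1) ^ k *
          (algebraMap K (Polynomial K) (c s) * ((T * (T + Dd) * u) ^ s.1 * T ^ s.2)) =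
        (1 ^ s.1 - (u * (Dd * T + 1)) ^ s.1) *
          (Polynomial.C (c s) * ((T * (T + Dd)) ^ s.1 * (Dd * T + 1) ^ k * T ^ s.2)) := by
      rw [mul_pow _ u, mul_pow u, Polynomial.algebraMap_eq]
      ring
    rw [e5]
    exact e4.mul_right _
  have h3 := dvd_add h2 (h1.mul_left ((Dd * T + 1) ^ m))
  simpa using h3

lemma Gpoly_zero {K : Type*} [Field K] [CharZero K] (m : ℕ) (hm : 0 < m) (D : Finset (ℕ × ℕ))
    (hD : ∀ s ∈ D, s.1 ≤ m) (hD1 : ∀ s ∈ D, m ≤ s.1 + s.2) (hD2 : ∀ s ∈ D, s.1 + s.2 < 2 * m)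
    (c : ℕ × ℕ → K) (d : K) (hd1 : d + 1 ≠ 0) (hd2 : -d + 1 ≠ 0)
    (h1 : ∀ β : ℕ × ℕ, β.1 + β.2 < m → evalPt K (1, 1) (derivOp K β (Fpoly D c)) = 0)
    (h2 : ∀ β : ℕ × ℕ, β.1 + β.2 < m → evalPt K (1, -1) (derivOp K β (Fpoly D c)) = 0) :
    Gpoly m D c d = 0 := by
  have a1 := Gpoly_dvd m hm D hD c d 1 (by simp) (by simpa using hd1) h1
  have a2 := Gpoly_dvd m hm D hD c d (-1) (by simp) (by simpa using hd2) h2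
  have a3 : (Polynomial.X - Polynomial.C 0) ^ m ∣ Gpoly m D c d := by
    apply Finset.dvd_sum
    intro s hs
    refine Dvd.dvd.mul_left ?_ _
    refine (pow_dvd_pow _ (hD1 s hs)).trans ⟨(Polynomial.X + Polynomial.C d) ^ s.1 *
      (Polynomial.C d * Polynomial.X + 1) ^ (m - s.1), ?_⟩
    rw [Polynomial.C_0, sub_zero, mul_pow]
    ring
  have cop : ∀ a b : K, a ≠ b → IsCoprime ((Polynomial.X - Polynomial.C a) ^ m)
      ((Polynomial.X - Polynomial.C b) ^ m) := fun a b hab =>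
    (Polynomial.isCoprime_X_sub_C_of_isUnit_sub (sub_ne_zero.2 hab).isUnit).pow
  have hne : (1 : K) ≠ -1 := by
    intro h
    have : (2 : K) = 0 := by linear_combination h
    exact two_ne_zero this
  have a4 := (cop 1 (-1) hne).mul_dvd a1 a2
  have a5 := (IsCoprime.mul_left (cop 1 0 one_ne_zero)
    (cop (-1) 0 (neg_ne_zero.2 one_ne_zero))).mul_dvd a4 a3
  apply Polynomial.eq_zero_of_dvd_of_natDegree_lt a5
  have hdeg : ∀ a : K, ((Polynomial.X - Polynomial.C a) ^ m).natDegree = m := fun a => by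
    rw [Polynomial.natDegree_pow, Polynomial.natDegree_X_sub_C, mul_one]
  have hmon : ∀ a : K, ((Polynomial.X - Polynomial.C a) ^ m).Monic := fun a =>
    (Polynomial.monic_X_sub_C a).pow m
  rw [((hmon _).mul (hmon _)).natDegree_mul (hmon _), (hmon _).natDegree_mul (hmon _),
    hdeg, hdeg, hdeg]
  have : (Gpoly m D c d).natDegree ≤ 3 * m - 1 := by
    apply Polynomial.natDegree_sum_le_of_forall_le
    intro s hs
    have b1 := hD s hs
    have b3 := hD2 s hs
    refine (Polynomial.natDegree_C_mul_le _ _).trans ?_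
    have c1 : ((Polynomial.X * (Polynomial.X + Polynomial.C d)) ^ s.1 : Polynomial K).natDegree
        ≤ s.1 * 2 := Polynomial.natDegree_pow_le_of_le _ (by compute_degree)
    have c2 : ((Polynomial.C d * Polynomial.X + 1) ^ (m - s.1) : Polynomial K).natDegree
        ≤ (m - s.1) * 1 := Polynomial.natDegree_pow_le_of_le _ (by compute_degree)
    have c3 : (Polynomial.X ^ s.2 : Polynomial K).natDegree ≤ s.2 :=
      Polynomial.natDegree_X_pow_le _
    refine (Polynomial.natDegree_mul_le_of_le (Polynomial.natDegree_mul_le_of_le c1 c2) c3).trans ?_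
    omega
  omega

lemma F_zero {K : Type*} [Field K] [CharZero K] (m : ℕ) (hm : 0 < m) (D : Finset (ℕ × ℕ))
    (hD : ∀ s ∈ D, s.1 ≤ m) (hD1 : ∀ s ∈ D, m ≤ s.1 + s.2) (hD2 : ∀ s ∈ D, s.1 + s.2 < 2 * m)
    (c : ℕ × ℕ → K)
    (h1 : ∀ β : ℕ × ℕ, β.1 + β.2 < m → evalPt K (1, 1) (derivOp K β (Fpoly D c)) = 0)
    (h2 : ∀ β : ℕ × ℕ, β.1 + β.2 < m → evalPt K (1, -1) (derivOp K β (Fpoly D c)) = 0) :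
    Fpoly D c = 0 := by
  have key : ∀ x t : K, t ≠ 0 → t - 1 ≠ 0 → t + 1 ≠ 0 → x - 1 ≠ 0 → x - t ≠ 0 → x + t ≠ 0 →
      aeval (fun i : Fin 2 => if i = 0 then x else t) (Fpoly D c) = 0 := by
    intro x t ht ht1 ht2 hx hxt hxt2
    set d := (t ^ 2 - x) / (t * (x - 1)) with hd
    have hd1 : d + 1 ≠ 0 := by
      have : d + 1 = (t - 1) * (x + t) / (t * (x - 1)) := by rw [hd]; field_simp; ring
      rw [this]
      exact div_ne_zero (mul_ne_zero ht1 hxt2) (mul_ne_zero ht hx)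
    have hd2 : -d + 1 ≠ 0 := by
      have : -d + 1 = (t + 1) * (x - t) / (t * (x - 1)) := by rw [hd]; field_simp; ring
      rw [this]
      exact div_ne_zero (mul_ne_zero ht2 hxt) (mul_ne_zero ht hx)
    have hq : d * t + 1 = (t - 1) * (t + 1) / (x - 1) := by rw [hd]; field_simp; ring
    have hq0 : d * t + 1 ≠ 0 := by
      rw [hq]; exact div_ne_zero (mul_ne_zero ht1 ht2) hx
    have hn : t * (t + d) = x * (d * t + 1) := by rw [hd]; field_simp; ring
    have hG := Gpoly_zero m hm D hD hD1 hD2 c d hd1 hd2 h1 h2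
    have hG2 := congrArg (Polynomial.eval t) hG
    rw [Gpoly, Polynomial.eval_finsetSum] at hG2
    rw [aeval_Fpoly]
    apply (mul_eq_zero.1 (?_ : (d * t + 1) ^ m * _ = 0)).resolve_left (pow_ne_zero _ hq0)
    rw [Polynomial.eval_zero] at hG2
    rw [← hG2, Finset.mul_sum]
    refine Finset.sum_congr rfl fun s hs => ?_
    obtain ⟨k, hk⟩ := Nat.exists_eq_add_of_le (hD s hs)
    have e2 : m - s.1 = k := by omega
    have e3 : (d * t + 1) ^ m = (d * t + 1) ^ s.1 * (d * t + 1) ^ k := by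
      rw [← pow_add, ← hk]
    rw [e2, e3]
    simp only [Polynomial.eval_mul, Polynomial.eval_pow, Polynomial.eval_add, Polynomial.eval_C,
      Polynomial.eval_X, Polynomial.eval_one, hn, Algebra.algebraMap_self, RingHom.id_apply]
    rw [mul_pow]
    ring
  set x : MvPolynomial (Fin 2) K := X 0 with hx
  set t : MvPolynomial (Fin 2) K := X 1 with ht
  have hprod : t * (t - 1) * (t + 1) * (x - 1) * (x - t) * (x + t) * Fpoly D c = 0 := by
    apply MvPolynomial.funext
    intro z
    have hz : eval z (Fpoly D c) = aeval (fun i : Fin 2 => if i = 0 then z 0 else z 1)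
        (Fpoly D c) := by
      rw [← MvPolynomial.aeval_eq_eval]
      congr 2
      funext i
      fin_cases i <;> rfl
    simp only [map_mul, map_sub, map_add, map_one, hx, ht, eval_X, map_zero, hz]
    by_contra hne
    simp only [mul_eq_zero, not_or] at hne
    obtain ⟨⟨⟨⟨⟨⟨n1, n2⟩, n3⟩, n4⟩, n5⟩, n6⟩, n7⟩ := hne
    exact n7 (key _ _ n1 n2 n3 n4 n5 n6)
  have nz : ∀ (P : MvPolynomial (Fin 2) K) (a b : K),
      aeval (fun i : Fin 2 => if i = 0 then a else b) P ≠ 0 → P ≠ 0 := by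
    rintro P a b h rfl
    simp at h
  refine (mul_eq_zero.1 hprod).resolve_left ?_
  apply nz _ 3 2
  simp only [map_mul, map_sub, map_add, map_one, hx, ht, aeval_X]
  norm_num

lemma card_D (m : ℕ) : ((Finset.range (m + 1) ×ˢ Finset.range (2 * m)).filter
          fun d => m ≤ d.1 + d.2 ∧ d.1 + d.2 ≤ 2 * m - 1).card = (m + 1) * m := by
  have : ((Finset.range (m + 1) ×ˢ Finset.range m)).card = (m + 1) * m := by simp
  rw [← this]
  refine Finset.card_bij' (fun d _ => (d.1, d.1 + d.2 - m)) (fun d _ => (d.1, d.2 + m - d.1))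
    ?_ ?_ ?_ ?_
  all_goals
    rintro ⟨a, b⟩ h
    simp only [Finset.mem_filter, Finset.mem_product, Finset.mem_range, Prod.mk.injEq, true_and] at h ⊢
    omega

/-- Let `m ≥ 1` and
`D = (m^{↑m}, m^{↑m−1}, …, m^{↑0}) = {(i,j) : i ≤ m, m−i ≤ j ≤ 2m−1−i}`.
Then `L_D(m^{×2})` is non-special and `vdim L_D(m^{×2}) = −1`. -/
theorem statement8 {K : Type*} [Field K] [CharZero K] (m : ℕ) (hm : 0 < m) :
    nonSpecial K
        ((Finset.range (m + 1) ×ˢ Finset.range (2 * m)).filter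
          fun d => m ≤ d.1 + d.2 ∧ d.1 + d.2 ≤ 2 * m - 1)
        (fun _ : Fin 2 => m) ∧
      vdimSys ((Finset.range (m + 1) ×ˢ Finset.range (2 * m)).filter
          fun d => m ≤ d.1 + d.2 ∧ d.1 + d.2 ≤ 2 * m - 1)
        (fun _ : Fin 2 => m) = -1 := by
  have hv : vdimSys ((Finset.range (m + 1) ×ˢ Finset.range (2 * m)).filter
          fun d => m ≤ d.1 + d.2 ∧ d.1 + d.2 ≤ 2 * m - 1)
        (fun _ : Fin 2 => m) = -1 := by
    have h2 := Nat.triangle_succ m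
    have h3 : (m + 1).choose 2 * 2 = (m + 1) * m := by
      rw [Nat.choose_two_right, Nat.div_mul_cancel]
      · simp
      · simpa using (Nat.even_mul_pred_self (m + 1)).two_dvd
    rw [vdimSys, card_D, ← h3]
    simp
    ring
  refine ⟨?_, hv⟩
  rw [nonSpecial, hv, max_self, dimSys]
  apply IsLeast.csInf_eq
  constructor
  · refine ⟨fun j => if j = 0 then (1, 1) else (1, -1), ?_⟩
    simp only
    have : linSysPts K ((Finset.range (m + 1) ×ˢ Finset.range (2 * m)).filter
          fun d => m ≤ d.1 + d.2 ∧ d.1 + d.2 ≤ 2 * m - 1)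
        (fun _ : Fin 2 => m) (fun j => if j = 0 then (1, 1) else (1, -1)) = ⊥ := by
      rw [eq_bot_iff]
      intro F hF
      rw [linSysPts, Submodule.mem_inf, monoSpan,
        Submodule.mem_span_image_finset_iff_exists_fun'] at hF
      obtain ⟨⟨c, hc⟩, hF⟩ := hF
      simp only [Submodule.mem_iInf, LinearMap.mem_ker, LinearMap.comp_apply] at hF
      rw [Submodule.mem_bot, ← hc]
      rw [← hc] at hF
      refine F_zero m hm _ ?_ ?_ ?_ c (fun β hβ => hF 0 β hβ)
        (fun β hβ => hF 1 β hβ)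
      all_goals
        rintro ⟨a, b⟩ h
        simp only [Finset.mem_filter, Finset.mem_product, Finset.mem_range] at h ⊢
        omega
    rw [this]
    simp
  · rintro _ ⟨p, rfl⟩
    simp only
    omega
end

section
/- Let m,k be positive integers, h = m(m+1), p = 2k+h−1, and let D = (h^{↑k−1},h^{↑k−2},…,h^{↑0},(h−1)^{↑0},(h−2)^{↑0},…,1^{↑0}). If every system in the set EoLS(m) is non-special, then the system L = L_D(m^{×p}) is non-special. -/
open MvPolynomial

/-- The diagram `(h^{↑k−1}, h^{↑k−2}, …, h^{↑0}, (h−1)^{↑0}, (h−2)^{↑0}, …, 1^{↑0})`: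
columns `i = 0, …, k−1` consist of `h` points starting at height `k−1−i`, and columns
`i = k, …, k+h−2` consist of `k+h−1−i` points starting at height `0`.  Explicitly it is
`{(i,j) : i + j ≤ k+h−2 ∧ (k ≤ i ∨ k−1 ≤ i+j)}`. -/
def eolsDiagram (h k : ℕ) : Finset (ℕ × ℕ) :=
  (Finset.range (k + h - 1) ×ˢ Finset.range (k + h - 1)).filter
    (fun x => x.1 + x.2 ≤ k + h - 2 ∧ (k ≤ x.1 ∨ k - 1 ≤ x.1 + x.2))

namespace Eols

theorem gen {K : Type*} [Field K] [CharZero K] {ι κ : Type*} [Fintype ι] [Fintype κ]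
    [DecidableEq κ] [DecidableEq ι]
    (M : Matrix ι κ (Polynomial K)) (s0 : K)
    (h : ∀ v, (M.map (Polynomial.eval s0)).mulVec v = 0 → v = 0)
    (q : Polynomial K) (hq : q ≠ 0) :
    ∃ s, q.eval s ≠ 0 ∧ ∀ v, (M.map (Polynomial.eval s)).mulVec v = 0 → v = 0 := by
  obtain ⟨g, hg⟩ := LinearMap.exists_leftInverse_of_injective
    (Matrix.toLin' (M.map (Polynomial.eval s0))) (by
      rw [LinearMap.ker_eq_bot']
      intro v hv
      exact h v (by simpa using hv))
  set N := LinearMap.toMatrix' g with hN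
  have hNM : N * M.map (Polynomial.eval s0) = 1 := by
    have := congrArg LinearMap.toMatrix' hg
    rw [LinearMap.toMatrix'_comp, LinearMap.toMatrix'_toLin', LinearMap.toMatrix'_id] at this
    exact this
  set p := ((N.map (Polynomial.C)) * M).det with hp
  have hev : ∀ s, p.eval s = (N * M.map (Polynomial.eval s)).det := by
    intro s
    have := RingHom.map_det (Polynomial.evalRingHom s) ((N.map (Polynomial.C)) * M)
    rw [← hp] at this
    rw [← Polynomial.coe_evalRingHom, this]
    congr 1
    ext i j
    simp [Matrix.mul_apply, Polynomial.eval_finsetSum]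
  have hp0 : p ≠ 0 := by
    intro h0
    have := hev s0
    rw [hNM, h0] at this
    simp at this
  obtain ⟨s, hs⟩ : ∃ s, (p * q).eval s ≠ 0 := by
    by_contra! hcon
    exact mul_ne_zero hp0 hq (Polynomial.funext (by simpa using hcon))
  rw [Polynomial.eval_mul] at hs
  refine ⟨s, right_ne_zero_of_mul hs, fun v hv => ?_⟩
  have hd := left_ne_zero_of_mul hs
  rw [hev] at hd
  refine Matrix.eq_zero_of_mulVec_eq_zero hd ?_
  rw [← Matrix.mulVec_mulVec, hv, Matrix.mulVec_zero]

theorem gen' {K : Type*} [Field K] [CharZero K] {ι : Type*} [Finite ι] (D : Finset (ℕ × ℕ))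
    (M : ι → ℕ × ℕ → Polynomial K) (s0 : K)
    (h : ∀ c : ℕ × ℕ → K, (∀ i, ∑ d ∈ D, c d * (M i d).eval s0 = 0) → ∀ d ∈ D, c d = 0)
    (q : Polynomial K) (hq : q ≠ 0) :
    ∃ s, q.eval s ≠ 0 ∧
      ∀ c : ℕ × ℕ → K, (∀ i, ∑ d ∈ D, c d * (M i d).eval s = 0) → ∀ d ∈ D, c d = 0 := by
  classical
  have := Fintype.ofFinite ι
  obtain ⟨s, hs, H⟩ := gen (Matrix.of fun (i : ι) (d : D) => M i d.1) s0 (by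
    intro v hv
    have := h (fun d => if hd : d ∈ D then v ⟨d, hd⟩ else 0) (by
      intro i
      have h1 := congrFun hv i
      simp only [Matrix.mulVec, dotProduct, Matrix.map_apply, Matrix.of_apply, Pi.zero_apply] at h1
      rw [← Finset.sum_attach, ← h1]
      refine Finset.sum_congr rfl fun d _ => ?_
      simp [mul_comm])
    ext d
    simpa using this d.1 d.2) q hq
  refine ⟨s, hs, fun c hc d hd => ?_⟩
  have := H (fun d => c d.1) (by
    ext i
    simp only [Matrix.mulVec, dotProduct, Matrix.map_apply, Matrix.of_apply, Pi.zero_apply]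
    rw [← hc i, ← Finset.sum_attach D]
    refine Finset.sum_congr rfl fun d _ => ?_
    ring)
  exact congrFun this ⟨d, hd⟩

/-- products of descending factorials -/
def gB (K : Type*) [Field K] (β d : ℕ × ℕ) : K :=
  (d.1.descFactorial β.1 : K) * (d.2.descFactorial β.2 : K)

/-- existence of points in the torus imposing independent conditions -/
def Good (K : Type*) [Field K] (m : ℕ) (D : Finset (ℕ × ℕ)) (r : ℕ) : Prop :=
  ∃ P : Fin r → K × K, (∀ j, (P j).1 ≠ 0 ∧ (P j).2 ≠ 0) ∧ ∀ c : ℕ × ℕ → K,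
    (∀ j, ∀ β : ℕ × ℕ, β.1 + β.2 < m →
      ∑ d ∈ D, c d * (gB K β d * ((P j).1 ^ d.1 * (P j).2 ^ d.2)) = 0) → ∀ d ∈ D, c d = 0

instance finB (m : ℕ) : Finite {β : ℕ × ℕ // β.1 + β.2 < m} := by
  apply Set.Finite.to_subtype (s := {β : ℕ × ℕ | β.1 + β.2 < m})
  refine Set.Finite.subset (Finset.finite_toSet (Finset.range m ×ˢ Finset.range m)) ?_
  rintro ⟨a, b⟩ h
  simp at h ⊢
  omega

theorem Good.mono {K : Type*} [Field K] {m : ℕ} {D D' : Finset (ℕ × ℕ)} {r : ℕ}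
    (h : Good K m D r) (hD : D' ⊆ D) : Good K m D' r := by
  obtain ⟨P, hP, H⟩ := h
  refine ⟨P, hP, fun c hc d hd => ?_⟩
  have := H (fun d => if d ∈ D' then c d else 0) (by
    intro j β hβ
    refine Eq.trans (Finset.sum_subset hD ?_).symm
      (Eq.trans (Finset.sum_congr rfl fun d hd => ?_) (hc j β hβ))
    · intro d _ hd
      simp [hd]
    · simp [hd]) d (hD hd)
  simpa [hd] using this

theorem Good.merge {K : Type*} [Field K] [CharZero K] {m : ℕ} {D : Finset (ℕ × ℕ)} {r1 r2 : ℕ}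
    (a b e : ℤ)
    (h1 : Good K m (D.filter fun d => a * d.1 + b * d.2 + e ≤ 0) r1)
    (h2 : Good K m (D.filter fun d => 0 < a * d.1 + b * d.2 + e) r2) :
    Good K m D (r1 + r2) := by
  classical
  obtain ⟨P1, hP1, H1⟩ := h1
  obtain ⟨P2, hP2, H2⟩ := h2
  set w : ℕ × ℕ → ℤ := fun d => a * d.1 + b * d.2 + e with hw
  let B := {β : ℕ × ℕ // β.1 + β.2 < m}
  let M : (Fin r1 × B) ⊕ (Fin r2 × B) → ℕ × ℕ → Polynomial K := Sum.elim
    (fun i d => Polynomial.C (gB K i.2.1 d * ((P1 i.1).1 ^ d.1 * (P1 i.1).2 ^ d.2)) *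
      (if 0 < w d then Polynomial.X ^ (w d).toNat else 1))
    (fun i d => Polynomial.C (gB K i.2.1 d * ((P2 i.1).1 ^ d.1 * (P2 i.1).2 ^ d.2)) *
      (if w d ≤ 0 then Polynomial.X ^ (-w d).toNat else 1))
  obtain ⟨s, hs, H⟩ := gen' D M 0 (by
    intro c hc
    have hA := H1 c (by
      intro j β hβ
      rw [← hc (Sum.inl (j, ⟨β, hβ⟩)), Finset.sum_filter]
      refine Finset.sum_congr rfl fun d _ => ?_
      by_cases hd : w d ≤ 0
      · have h2 : ¬ 0 < w d := not_lt.mpr hd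
        have h3 : a * d.1 + b * d.2 + e ≤ 0 := hd
        simp [M, h2, h3]
      · have h2 : 0 < w d := not_le.mp hd
        have h3 : ¬ a * d.1 + b * d.2 + e ≤ 0 := hd
        have h4 : (w d).toNat ≠ 0 := by omega
        simp only [M, h2, h3, Sum.elim_inl, if_true, if_false]
        simp [h4])
    have hB := H2 c (by
      intro j β hβ
      rw [← hc (Sum.inr (j, ⟨β, hβ⟩)), Finset.sum_filter]
      refine Finset.sum_congr rfl fun d hdD => ?_
      by_cases hd : w d ≤ 0
      · have h0 := hA d (Finset.mem_filter.mpr ⟨hdD, hd⟩)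
        simp [h0]
      · have h2 : 0 < w d := not_le.mp hd
        have h3 : 0 < a * d.1 + b * d.2 + e := h2
        simp [M, hd, h3])
    intro d hd
    by_cases h : w d ≤ 0
    · exact hA d (Finset.mem_filter.mpr ⟨hd, h⟩)
    · exact hB d (Finset.mem_filter.mpr ⟨hd, not_le.mp h⟩)) Polynomial.X Polynomial.X_ne_zero
  simp only [Polynomial.eval_X] at hs
  refine ⟨Fin.append P1 (fun j => (s ^ (-a) * (P2 j).1, s ^ (-b) * (P2 j).2)), ?_, ?_⟩
  · intro j
    refine Fin.addCases (fun i => ?_) (fun i => ?_) j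
    · simpa using hP1 i
    · simpa [zpow_eq_zero_iff, hs, zpow_ne_zero] using hP2 i
  · intro c hc d hd
    have key := H (fun d => if 0 < w d then c d * s ^ (-w d) else c d) (by
      rintro (⟨j, β, hβ⟩ | ⟨j, β, hβ⟩)
      · have := hc (Fin.castAdd r2 j) β hβ
        simp only [Fin.append_left] at this
        rw [← this]
        refine Finset.sum_congr rfl fun d _ => ?_
        by_cases h : 0 < w d
        · have h5 : s ^ (-w d) * s ^ (w d).toNat = 1 := by
            rw [← zpow_natCast, ← zpow_add₀ hs, Int.toNat_of_nonneg h.le]; simp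
          simp only [M, h, if_true, Sum.elim_inl, Polynomial.eval_mul, Polynomial.eval_C,
            Polynomial.eval_pow, Polynomial.eval_X]
          linear_combination (c d * (gB K β d * ((P1 j).1 ^ d.1 * (P1 j).2 ^ d.2))) * h5
        · simp [M, h]
      · have := hc (Fin.natAdd r1 j) β hβ
        simp only [Fin.append_right] at this
        rw [← mul_zero (s ^ (-e)), ← this, Finset.mul_sum]
        refine Finset.sum_congr rfl fun d _ => ?_
        have h6 : s ^ (-w d) = s ^ (-e) * ((s ^ (-a)) ^ d.1 * (s ^ (-b)) ^ d.2) := by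
          rw [← zpow_natCast (s ^ (-a)), ← zpow_natCast (s ^ (-b)), ← zpow_mul, ← zpow_mul,
            ← zpow_add₀ hs, ← zpow_add₀ hs]
          congr 1
          simp only [hw]; ring
        have h7 : (if 0 < w d then c d * s ^ (-w d) else c d) *
            (M (Sum.inr (j, ⟨β, hβ⟩)) d).eval s = c d * s ^ (-w d) *
              (gB K β d * ((P2 j).1 ^ d.1 * (P2 j).2 ^ d.2)) := by
          by_cases h : 0 < w d
          · have h' : ¬ w d ≤ 0 := not_le.mpr h
            simp [M, h, h']
          · have h' : w d ≤ 0 := not_lt.mp h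
            have h8 : s ^ (-w d) = s ^ (-w d).toNat := by
              rw [← zpow_natCast, Int.toNat_of_nonneg (by omega)]
            rw [h8]
            simp only [M, h, h', if_true, if_false, Sum.elim_inr, Polynomial.eval_mul,
              Polynomial.eval_C, Polynomial.eval_pow, Polynomial.eval_X]
            ring
        rw [h7, h6, mul_pow, mul_pow]
        ring) d hd
    by_cases h : 0 < w d
    · simpa [h, zpow_ne_zero, hs] using key
    · simpa [h] using key

/-- functions of degree less than `m` -/
def W (K : Type*) [Field K] (m : ℕ) : Submodule K (ℕ × ℕ → K) :=
  Submodule.span K {f | ∃ β : ℕ × ℕ, β.1 + β.2 < m ∧ f = gB K β}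

theorem desc_mul {K : Type*} [Field K] (n k : ℕ) :
    (n : K) * (n.descFactorial k : K) = (n.descFactorial (k + 1) : K) +
      k * (n.descFactorial k : K) := by
  rw [Nat.descFactorial_succ]
  rcases le_or_gt k n with h | h
  · push_cast [Nat.cast_sub h]; ring
  · rw [Nat.descFactorial_of_lt h]; simp

theorem gB_mem {K : Type*} [Field K] {m : ℕ} {β : ℕ × ℕ} (h : β.1 + β.2 < m) :
    gB K β ∈ W K m := Submodule.subset_span ⟨β, h, rfl⟩

theorem W_mul {K : Type*} [Field K] (a b e : K) {m : ℕ} {f : ℕ × ℕ → K} (hf : f ∈ W K m) :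
    (fun d => (a * d.1 + b * d.2 + e) * f d) ∈ W K (m + 1) := by
  unfold W at hf
  induction hf using Submodule.span_induction with
  | mem f hf =>
    obtain ⟨β, hβ, rfl⟩ := hf
    have : (fun d : ℕ × ℕ => (a * d.1 + b * d.2 + e) * gB K β d) =
        a • gB K (β.1 + 1, β.2) + b • gB K (β.1, β.2 + 1) + (a * β.1 + b * β.2 + e) • gB K β := by
      ext d
      simp only [gB, Pi.add_apply, Pi.smul_apply, smul_eq_mul]
      have h1 := desc_mul (K := K) d.1 β.1
      have h2 := desc_mul (K := K) d.2 β.2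
      linear_combination a * (d.2.descFactorial β.2 : K) * h1 +
        b * (d.1.descFactorial β.1 : K) * h2
    rw [this]
    refine Submodule.add_mem _ (Submodule.add_mem _ ?_ ?_) ?_ <;>
      refine Submodule.smul_mem _ _ (gB_mem ?_) <;> simp <;> omega
  | zero => simp; exact Submodule.zero_mem _
  | add f g _ _ hf hg =>
    convert Submodule.add_mem _ hf hg using 1
    ext d; simp; ring
  | smul t f _ hf =>
    convert Submodule.smul_mem _ t hf using 1
    ext d; simp; ring

theorem W_mono {K : Type*} [Field K] {m n : ℕ} (h : m ≤ n) : W K m ≤ W K n :=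
  Submodule.span_mono fun _ ⟨β, hβ, h'⟩ => ⟨β, hβ.trans_le h, h'⟩

theorem W_prod {K : Type*} [Field K] (a b : K) (A : Finset ℕ) {m : ℕ} {f : ℕ × ℕ → K}
    (hf : f ∈ W K m) :
    (fun d => (∏ x ∈ A, (a * d.1 + b * d.2 - x)) * f d) ∈ W K (m + A.card) := by
  classical
  induction A using Finset.induction_on with
  | empty => simpa using hf
  | insert x A hx ih =>
    have := W_mul a b (-(x : K)) ih
    rw [Finset.card_insert_of_notMem hx, ← add_assoc]
    convert this using 1
    ext d
    rw [Finset.prod_insert hx]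
    ring

theorem W_tri {K : Type*} [Field K] (A B E : Finset ℕ) {m : ℕ}
    (hm : A.card + B.card + E.card < m) :
    (fun d : ℕ × ℕ => (∏ x ∈ A, ((d.1 : K) - x)) * ((∏ x ∈ B, ((d.2 : K) - x)) *
      (∏ x ∈ E, ((d.1 : K) + d.2 - x)))) ∈ W K m := by
  have h0 : gB K (0, 0) ∈ W K 1 := gB_mem (by simp)
  have := W_prod 1 0 A (W_prod 0 1 B (W_prod 1 1 E h0))
  refine W_mono (m := 1 + E.card + B.card + A.card) (by omega) ?_
  convert this using 1
  ext d
  simp [gB]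

theorem cond_W {K : Type*} [Field K] {m : ℕ} {D : Finset (ℕ × ℕ)} {c x : ℕ × ℕ → K}
    (h : ∀ β : ℕ × ℕ, β.1 + β.2 < m → ∑ d ∈ D, c d * (gB K β d * x d) = 0)
    {f : ℕ × ℕ → K} (hf : f ∈ W K m) : ∑ d ∈ D, c d * (f d * x d) = 0 := by
  unfold W at hf
  induction hf using Submodule.span_induction with
  | mem f hf =>
    obtain ⟨β, hβ, rfl⟩ := hf
    exact h β hβ
  | zero => simp
  | add f g _ _ hf hg =>
    rw [← add_zero (0 : K)]
    nth_rewrite 1 [← hf]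
    rw [← hg, ← Finset.sum_add_distrib]
    refine Finset.sum_congr rfl fun d _ => ?_
    simp; ring
  | smul t f _ hf =>
    rw [← mul_zero t, ← hf, Finset.mul_sum]
    refine Finset.sum_congr rfl fun d _ => ?_
    simp; ring

theorem good_tri {K : Type*} [Field K] [CharZero K] {m : ℕ} {D : Finset (ℕ × ℕ)}
    (h : ∀ d0 ∈ D, ∃ A B E : Finset ℕ, A.card + B.card + E.card < m ∧
      d0.1 ∉ A ∧ d0.2 ∉ B ∧ d0.1 + d0.2 ∉ E ∧
      ∀ d ∈ D, d ≠ d0 → d.1 ∈ A ∨ d.2 ∈ B ∨ d.1 + d.2 ∈ E) : Good K m D 1 := by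
  refine ⟨fun _ => (1, 1), by simp, fun c hc d0 hd0 => ?_⟩
  obtain ⟨A, B, E, hcard, hA, hB, hE, H⟩ := h d0 hd0
  have := cond_W (x := fun d => (1 : K) ^ d.1 * 1 ^ d.2) (hc 0) (W_tri A B E hcard)
  rw [Finset.sum_eq_single d0] at this
  · simp only [one_pow, mul_one, mul_eq_zero, Finset.prod_eq_zero_iff, sub_eq_zero,
      ← Nat.cast_add, Nat.cast_inj] at this
    rcases this with h | ⟨x, hx, rfl⟩ | ⟨x, hx, rfl⟩ | ⟨x, hx, rfl⟩
    · exact h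
    · exact absurd hx hA
    · exact absurd hx hB
    · exact absurd hx hE
  · intro d hd hne
    simp only [one_pow, mul_one, mul_eq_zero, Finset.prod_eq_zero_iff, sub_eq_zero,
      ← Nat.cast_add, Nat.cast_inj]
    rcases H d hd hne with h | h | h
    · exact Or.inr (Or.inl ⟨_, h, rfl⟩)
    · exact Or.inr (Or.inr (Or.inl ⟨_, h, rfl⟩))
    · exact Or.inr (Or.inr (Or.inr ⟨_, h, rfl⟩))
  · exact fun h => absurd hd0 h

theorem good_par {K : Type*} [Field K] [CharZero K] {m c : ℕ} {D : Finset (ℕ × ℕ)}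
    (h : ∀ d ∈ D, d.1 ≤ m ∧ c ≤ d.1 + d.2 ∧ d.1 + d.2 < c + m) : Good K m D (1 + 1) := by
  refine Good.merge 0 (-1) c ?_ ?_
  · refine good_tri fun d0 hd0 => ?_
    rw [Finset.mem_filter] at hd0
    have h0 := h d0 hd0.1
    refine ⟨Finset.range d0.1, Finset.Ico c d0.2, Finset.Ioo (d0.1 + d0.2) (c + m),
      ?_, ?_, ?_, ?_, ?_⟩
    · simp; omega
    · simp
    · simp
    · simp
    · intro d hd hne
      rw [Finset.mem_filter] at hd
      have h1 := h d hd.1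
      have : ¬ (d.1 = d0.1 ∧ d.2 = d0.2) := fun h => hne (Prod.ext h.1 h.2)
      simp
      omega
  · refine good_tri fun d0 hd0 => ?_
    rw [Finset.mem_filter] at hd0
    have h0 := h d0 hd0.1
    refine ⟨Finset.Ioc d0.1 m, Finset.Ioo d0.2 c, Finset.Ico c (d0.1 + d0.2),
      ?_, ?_, ?_, ?_, ?_⟩
    · simp; omega
    · simp
    · simp
    · simp
    · intro d hd hne
      rw [Finset.mem_filter] at hd
      have h1 := h d hd.1
      have : ¬ (d.1 = d0.1 ∧ d.2 = d0.2) := fun h => hne (Prod.ext h.1 h.2)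
      simp
      omega

theorem good_strip {K : Type*} [Field K] [CharZero K] (m : ℕ) (n : ℕ) : ∀ (c : ℕ)
    (D : Finset (ℕ × ℕ)),
    (∀ d ∈ D, d.1 ≤ m ∧ c ≤ d.1 + d.2 ∧ d.1 + d.2 < c + m * n) → Good K m D (2 * n) := by
  induction n with
  | zero =>
    intro c D h
    refine ⟨fun _ => (1, 1), by simp, fun _ _ d hd => ?_⟩
    have := h d hd
    simp at this
    omega
  | succ n ih =>
    intro c D h
    refine Good.merge (r1 := 2 * n) (r2 := 1 + 1) 1 1 (1 - (c + m * n : ℕ)) ?_ ?_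
    · refine ih c _ fun d hd => ?_
      rw [Finset.mem_filter] at hd
      have := h d hd.1
      refine ⟨this.1, this.2.1, ?_⟩
      generalize m * n = q at *
      omega
    · refine good_par (c := c + m * n) fun d hd => ?_
      rw [Finset.mem_filter] at hd
      have := h d hd.1
      rw [mul_add] at this
      refine ⟨this.1, ?_, ?_⟩ <;>
      · generalize m * n = q at *
        omega

theorem desc_prod {K : Type*} [Field K] (v n k : ℕ) :
    ∏ x ∈ Finset.Ico v (v + k), (((n + v : ℕ) : K) - x) = (n.descFactorial k : K) := by
  induction k with
  | zero => simp
  | succ k ih =>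
    rw [← add_assoc, Finset.prod_Ico_succ_top (by omega), ih]
    have := desc_mul (K := K) n k
    push_cast
    linear_combination this

theorem Good.shift {K : Type*} [Field K] {m : ℕ} {D D' : Finset (ℕ × ℕ)} {r : ℕ} (v : ℕ)
    (h : Good K m D r) (hD : ∀ d ∈ D', v ≤ d.1 ∧ (d.1 - v, d.2) ∈ D) : Good K m D' r := by
  classical
  suffices hs : Good K m (D.image fun d => (d.1 + v, d.2)) r by
    refine hs.mono fun d hd => ?_
    rw [Finset.mem_image]
    refine ⟨_, (hD d hd).2, ?_⟩
    ext
    · simp [(hD d hd).1]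
    · rfl
  have hinj : Function.Injective (fun d : ℕ × ℕ => (d.1 + v, d.2)) := by
    intro d d' hdd
    simp only [Prod.mk.injEq] at hdd
    exact Prod.ext (by omega) hdd.2
  obtain ⟨P, hP, H⟩ := h
  refine ⟨P, hP, fun c hc => ?_⟩
  have := H (fun d => c (d.1 + v, d.2)) (by
    intro j β hβ
    have h1 := cond_W (x := fun d => (P j).1 ^ d.1 * (P j).2 ^ d.2) (hc j)
      (W_tri (Finset.Ico v (v + β.1)) (Finset.Ico 0 (0 + β.2)) ∅ (by simpa using hβ))
    rw [Finset.sum_image hinj.injOn] at h1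
    have h2 : (P j).1 ^ v ≠ 0 := pow_ne_zero _ (hP j).1
    refine (mul_eq_zero.mp ?_).resolve_left h2
    rw [← h1, Finset.mul_sum]
    refine Finset.sum_congr rfl fun d _ => ?_
    have e1 := desc_prod (K := K) v d.1 β.1
    have e2 := desc_prod (K := K) 0 d.2 β.2
    rw [add_zero] at e2
    simp only
    rw [e1, e2, gB, pow_add]
    simp only [Finset.prod_empty]
    ring)
  intro d hd
  obtain ⟨d, hd', rfl⟩ := Finset.mem_image.mp hd
  exact this d hd'

theorem mem_eols (h k : ℕ) (hk : 0 < k) (d : ℕ × ℕ) :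
    d ∈ eolsDiagram h k ↔ k - 1 ≤ d.1 + d.2 ∧ d.1 + d.2 < k - 1 + h := by
  simp only [eolsDiagram, Finset.mem_filter, Finset.mem_product, Finset.mem_range]
  by_cases hh : h = 0
  · subst hh
    constructor
    · rintro ⟨⟨h1, h2⟩, h3, h4⟩
      omega
    · omega
  · omega

theorem step {K : Type*} [Field K] [CharZero K] (m k : ℕ) (hm : 0 < m) (hk : 0 < k)
    (h : Good K m (eolsDiagram (m * (m + 1)) k) (2 * k + m * (m + 1) - 1)) :
    Good K m (eolsDiagram (m * (m + 1)) (k + (m + 1)))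
      (2 * (k + (m + 1)) + m * (m + 1) - 1) := by
  have hr : 2 * (k + (m + 1)) + m * (m + 1) - 1 =
      2 * (m + 1) + (2 * k + m * (m + 1) - 1) := by omega
  rw [hr]
  refine Good.merge 1 0 (-m) ?_ ?_
  · refine good_strip m (m + 1) (k + m) _ fun d hd => ?_
    rw [Finset.mem_filter, mem_eols _ _ (by omega)] at hd
    generalize m * (m + 1) = q at *
    omega
  · refine h.shift (m + 1) fun d hd => ?_
    rw [Finset.mem_filter, mem_eols _ _ (by omega)] at hd
    rw [mem_eols _ _ hk]
    generalize m * (m + 1) = q at *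
    simp only
    omega

theorem card_eols (h k : ℕ) (hk : 0 < k) :
    2 * (eolsDiagram h k).card = h * (2 * k + h - 1) := by
  have : (eolsDiagram h k) = (Finset.Ico (k - 1) (k - 1 + h)).biUnion
      (fun n => Finset.HasAntidiagonal.antidiagonal n) := by
    ext d
    rw [mem_eols _ _ hk]
    simp
  rw [this, Finset.card_biUnion]
  · simp only [Finset.Nat.card_antidiagonal]
    obtain ⟨k, rfl⟩ : ∃ l, k = l + 1 := ⟨k - 1, by omega⟩
    simp only [Nat.add_sub_cancel]
    clear this
    induction h with
    | zero => simp
    | succ h ih =>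
      rw [← add_assoc, Finset.sum_Ico_succ_top (by omega), mul_add, ih]
      have e1 : 2 * (k + 1) + h - 1 = 2 * k + h + 1 := by omega
      have e2 : 2 * (k + 1) + (h + 1) - 1 = 2 * k + h + 2 := by omega
      rw [e1, e2]; ring
  · intro x _ y _ hxy
    rw [Function.onFun, Finset.disjoint_left]
    intro d hd hd'
    simp at hd hd'
    omega

theorem vdim_eols (m k : ℕ) (hk : 0 < k) :
    vdimSys (eolsDiagram (m * (m + 1)) k) (fun _ : Fin (2 * k + m * (m + 1) - 1) => m) = -1 := by
  have h1 := card_eols (m * (m + 1)) k hk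
  have h2 : 2 * (m + 1).choose 2 = m * (m + 1) := by
    have := Nat.triangle_succ m
    have h3 := Nat.choose_two_right (m + 1)
    have h4 : 2 ∣ m * (m + 1) := (Nat.even_mul_succ_self m).two_dvd
    rw [h3, Nat.add_sub_cancel, mul_comm (m + 1) m]
    omega
  have h3 : (eolsDiagram (m * (m + 1)) k).card =
      (2 * k + m * (m + 1) - 1) * (m + 1).choose 2 := by
    nlinarith
  simp only [vdimSys, h3]
  simp

theorem linSys_le {K : Type*} [Field K] (D : Finset (ℕ × ℕ)) {r : ℕ}
    (m : Fin r → ℕ) (p : Fin r → K × K) : linSysPts K D m p ≤ monoSpan K D := inf_le_left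

theorem nonSpecial_iff {K : Type*} [Field K] (D : Finset (ℕ × ℕ)) {r : ℕ}
    (m : Fin r → ℕ) (hv : vdimSys D m = -1) :
    nonSpecial K D m ↔ ∃ p, linSysPts K D m p = ⊥ := by
  have hfin : Module.Finite K (monoSpan K D) := by
    unfold monoSpan
    exact FiniteDimensional.span_of_finite K (D.finite_toSet.image _)
  have hfin2 : ∀ p, Module.Finite K (linSysPts K D m p) := fun p =>
    Submodule.finiteDimensional_of_le (linSys_le D m p)
  have hbdd : BddBelow (Set.range fun p : Fin r → K × K =>
      (Module.finrank K ↥(linSysPts K D m p) : ℤ) - 1) := by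
    refine ⟨-1, ?_⟩
    rintro _ ⟨p, rfl⟩
    simp only
    omega
  unfold nonSpecial dimSys
  rw [hv, max_self]
  constructor
  · intro h
    obtain ⟨p, hp⟩ := Int.csInf_mem (Set.range_nonempty _) hbdd
    rw [h] at hp
    refine ⟨p, ?_⟩
    have := hfin2 p
    rw [← Submodule.finrank_eq_zero (R := K)]
    simp only at hp
    omega
  · rintro ⟨p, hp⟩
    apply le_antisymm
    · refine csInf_le hbdd ⟨p, ?_⟩
      simp [hp]
    · refine le_csInf (Set.range_nonempty _) ?_
      rintro _ ⟨p, rfl⟩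
      simp only
      omega

theorem pderiv_pow {K : Type*} [Field K] (i : Fin 2) (n : ℕ) (s : Fin 2 →₀ ℕ) (a : K) :
    ((pderiv i).toLinearMap ^ n : Module.End K (MvPolynomial (Fin 2) K)) (monomial s a) =
      monomial (s - Finsupp.single i n) (a * ((s i).descFactorial n : K)) := by
  induction n with
  | zero => simp
  | succ n ih =>
    rw [pow_succ', Module.End.mul_apply, ih]
    change pderiv i _ = _
    rw [pderiv_monomial, Nat.descFactorial_succ]
    congr 1
    · rw [tsub_tsub, ← Finsupp.single_add]
    · simp; ring

theorem eval_deriv {K : Type*} [Field K] (p : K × K) (β d : ℕ × ℕ) :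
    evalPt K p (derivOp K β (monomial (Finsupp.single (0 : Fin 2) d.1 + Finsupp.single 1 d.2)
      (1 : K))) = gB K β d * (p.1 ^ (d.1 - β.1) * p.2 ^ (d.2 - β.2)) := by
  rw [derivOp, Module.End.mul_apply, pderiv_pow, pderiv_pow, evalPt]
  simp only [AlgHom.toLinearMap_apply, aeval_monomial]
  rw [Finsupp.prod_fintype _ _ (by simp)]
  simp [gB, mul_comm]

theorem linSys_bot {K : Type*} [Field K] (D : Finset (ℕ × ℕ)) {r m : ℕ} (p : Fin r → K × K) :
    linSysPts K D (fun _ => m) p = ⊥ ↔ ∀ c : ℕ × ℕ → K,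
    (∀ j, ∀ β : ℕ × ℕ, β.1 + β.2 < m →
      ∑ d ∈ D, c d * (gB K β d * ((p j).1 ^ (d.1 - β.1) * (p j).2 ^ (d.2 - β.2))) = 0) →
      ∀ d ∈ D, c d = 0 := by
  classical
  let mon : ℕ × ℕ → MvPolynomial (Fin 2) K := fun d =>
    monomial (Finsupp.single (0 : Fin 2) d.1 + Finsupp.single 1 d.2) (1 : K)
  have hev : ∀ (c : ℕ × ℕ → K) j β, evalPt K (p j) (derivOp K β (∑ d ∈ D, c d • mon d)) =
      ∑ d ∈ D, c d * (gB K β d * ((p j).1 ^ (d.1 - β.1) * (p j).2 ^ (d.2 - β.2))) := by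
    intro c j β
    rw [map_sum, map_sum]
    refine Finset.sum_congr rfl fun d _ => ?_
    rw [map_smul, map_smul, eval_deriv, smul_eq_mul]
  have hmem : ∀ F, F ∈ linSysPts K D (fun _ => m) p ↔ F ∈ monoSpan K D ∧
      ∀ j, ∀ β : ℕ × ℕ, β.1 + β.2 < m → evalPt K (p j) (derivOp K β F) = 0 := by
    intro F
    simp [linSysPts, Submodule.mem_iInf]
  have hcoef : ∀ (c : ℕ × ℕ → K), ∀ d0 ∈ D, coeff (Finsupp.single (0 : Fin 2) d0.1 +
      Finsupp.single 1 d0.2) (∑ d ∈ D, c d • mon d) = c d0 := by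
    intro c d0 hd0
    rw [coeff_sum, Finset.sum_eq_single d0]
    · simp [mon]
    · intro d _ hne
      simp only [mon, coeff_smul, coeff_monomial]
      rw [if_neg]
      · simp
      · intro h
        apply hne
        have h0 := DFunLike.congr_fun h 0
        have h1 := DFunLike.congr_fun h 1
        simp at h0 h1
        exact Prod.ext h0 h1
    · exact fun h => absurd hd0 h
  rw [Submodule.eq_bot_iff]
  constructor
  · intro H c hc d hd
    have := H (∑ d ∈ D, c d • mon d) (by
      rw [hmem]
      refine ⟨?_, fun j β hβ => by rw [hev]; exact hc j β hβ⟩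
      refine Submodule.sum_mem _ fun d hd => Submodule.smul_mem _ _ (Submodule.subset_span ?_)
      exact ⟨d, hd, rfl⟩)
    rw [← hcoef c d hd, this, coeff_zero]
  · intro H F hF
    rw [hmem] at hF
    obtain ⟨hF1, hF2⟩ := hF
    obtain ⟨c, rfl⟩ : ∃ c : ℕ × ℕ → K, F = ∑ d ∈ D, c d • mon d := by
      unfold monoSpan at hF1
      rw [Submodule.mem_span_image_finset_iff_exists_fun] at hF1
      obtain ⟨c, hc⟩ := hF1
      refine ⟨fun d => if hd : d ∈ D then c ⟨d, hd⟩ else 0, ?_⟩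
      rw [← hc, ← Finset.sum_attach D]
      refine Finset.sum_congr rfl fun d _ => ?_
      simp [mon]
    have := H c (fun j β hβ => by rw [← hev]; exact hF2 j β hβ)
    exact Finset.sum_eq_zero fun d hd => by rw [this d hd, zero_smul]

theorem gB_pow {K : Type*} [Field K] (β d : ℕ × ℕ) (x y : K) :
    gB K β d * (x ^ d.1 * y ^ d.2) =
      x ^ β.1 * y ^ β.2 * (gB K β d * (x ^ (d.1 - β.1) * y ^ (d.2 - β.2))) := by
  by_cases h1 : d.1 < β.1
  · simp [gB, Nat.descFactorial_of_lt h1]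
  by_cases h2 : d.2 < β.2
  · simp [gB, Nat.descFactorial_of_lt h2]
  have e1 : x ^ d.1 = x ^ β.1 * x ^ (d.1 - β.1) := by rw [← pow_add]; congr 1; omega
  have e2 : y ^ d.2 = y ^ β.2 * y ^ (d.2 - β.2) := by rw [← pow_add]; congr 1; omega
  rw [e1, e2]; ring

theorem cond_iff {K : Type*} [Field K] (D : Finset (ℕ × ℕ)) (c : ℕ × ℕ → K) (β : ℕ × ℕ) (p : K × K)
    (h1 : p.1 ≠ 0) (h2 : p.2 ≠ 0) :
    ∑ d ∈ D, c d * (gB K β d * (p.1 ^ d.1 * p.2 ^ d.2)) = 0 ↔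
    ∑ d ∈ D, c d * (gB K β d * (p.1 ^ (d.1 - β.1) * p.2 ^ (d.2 - β.2))) = 0 := by
  have : ∑ d ∈ D, c d * (gB K β d * (p.1 ^ d.1 * p.2 ^ d.2)) = (p.1 ^ β.1 * p.2 ^ β.2) *
      ∑ d ∈ D, c d * (gB K β d * (p.1 ^ (d.1 - β.1) * p.2 ^ (d.2 - β.2))) := by
    rw [Finset.mul_sum]
    refine Finset.sum_congr rfl fun d _ => ?_
    rw [gB_pow]; ring
  rw [this, mul_eq_zero]
  simp [h1, h2]

theorem good_iff {K : Type*} [Field K] [CharZero K] (D : Finset (ℕ × ℕ)) {r m : ℕ} :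
    (∃ p : Fin r → K × K, linSysPts K D (fun _ => m) p = ⊥) ↔ Good K m D r := by
  constructor
  · rintro ⟨p, hp⟩
    rw [linSys_bot] at hp
    let M : Fin r × {β : ℕ × ℕ // β.1 + β.2 < m} → ℕ × ℕ → Polynomial K := fun i d =>
      Polynomial.C (gB K i.2.1 d) *
        ((Polynomial.X + Polynomial.C (p i.1).1) ^ (d.1 - i.2.1.1) *
          (Polynomial.X + Polynomial.C (p i.1).2) ^ (d.2 - i.2.1.2))
    obtain ⟨s, hs, H⟩ := gen' D M 0 (by
        intro c hc
        refine hp c fun j β hβ => ?_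
        simpa [M] using hc (j, ⟨β, hβ⟩))
      (∏ j, ((Polynomial.X + Polynomial.C (p j).1) * (Polynomial.X + Polynomial.C (p j).2)))
      (Finset.prod_ne_zero_iff.mpr fun j _ =>
        mul_ne_zero (Polynomial.X_add_C_ne_zero _) (Polynomial.X_add_C_ne_zero _))
    rw [Polynomial.eval_prod, Finset.prod_ne_zero_iff] at hs
    simp only [Polynomial.eval_mul, Polynomial.eval_add, Polynomial.eval_X,
      Polynomial.eval_C] at hs
    have hne : ∀ j, s + (p j).1 ≠ 0 ∧ s + (p j).2 ≠ 0 := fun j =>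
      mul_ne_zero_iff.mp (hs j (Finset.mem_univ j))
    refine ⟨fun j => (s + (p j).1, s + (p j).2), hne, fun c hc => H c ?_⟩
    rintro ⟨j, β, hβ⟩
    have := (cond_iff D c β (s + (p j).1, s + (p j).2) (hne j).1 (hne j).2).mp (hc j β hβ)
    simpa [M] using this
  · rintro ⟨P, hP, H⟩
    refine ⟨P, ?_⟩
    rw [linSys_bot]
    exact fun c hc => H c fun j β hβ => (cond_iff D c β _ (hP j).1 (hP j).2).mpr (hc j β hβ)

theorem main {K : Type*} [Field K] [CharZero K] (m : ℕ) (hm : 0 < m)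
    (hE : ∀ k', 1 ≤ k' → k' ≤ m + 1 →
      Good K m (eolsDiagram (m * (m + 1)) k') (2 * k' + m * (m + 1) - 1)) (k : ℕ) (hk : 0 < k) :
    Good K m (eolsDiagram (m * (m + 1)) k) (2 * k + m * (m + 1) - 1) := by
  induction k using Nat.strong_induction_on with
  | _ k ih =>
    by_cases h : k ≤ m + 1
    · exact hE k hk h
    · have := step (K := K) m (k - (m + 1)) hm (by omega) (ih _ (by omega) (by omega))
      have e : k - (m + 1) + (m + 1) = k := by omega
      rwa [e] at this

end Eols

/-- Let `m, k ≥ 1`, `h = m(m+1)`, `p = 2k + h − 1`, and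
`D = (h^{↑k−1}, …, h^{↑0}, (h−1)^{↑0}, …, 1^{↑0})`.  If every system in `EoLS(m)` is
non-special, then `L = L_D(m^{×p})` is non-special. -/
theorem statement11 {K : Type*} [Field K] [CharZero K]
    (m k : ℕ) (hm : 0 < m) (hk : 0 < k)
    (hEoLS : ∀ k', 1 ≤ k' → k' ≤ m + 1 →
      nonSpecial K (eolsDiagram (m * (m + 1)) k')
        (fun _ : Fin (2 * k' + m * (m + 1) - 1) => m)) :
    nonSpecial K (eolsDiagram (m * (m + 1)) k)
      (fun _ : Fin (2 * k + m * (m + 1) - 1) => m) := by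
  rw [Eols.nonSpecial_iff _ _ (Eols.vdim_eols m k hk), Eols.good_iff]
  refine Eols.main m hm (fun k' h1 h2 => ?_) k hk
  rw [← Eols.good_iff, ← Eols.nonSpecial_iff _ _ (Eols.vdim_eols m k' h1)]
  exact hEoLS k' h1 h2
end
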